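/- arXiv:2209.11987 — 14 statements merged into one kernel-verified Lean document; each statement's English description precedes it below -/
import Mathlib

section
/- In the abstract framework, every solution (u, θ) ∈ V × Z of the coupled problem satisfies the a priori bounds ‖θ‖ ≤ λ_ψ and ‖u‖ ≤ C₀ = (Λ + λ_q·λ_ψ)/C_min. -/
theorem le_div_of_mul_sq_le_mul {k M x : ℝ} (hk : 0 < k) (hM : 0 ≤ M) (hx : 0 ≤ x)
    (hsq : k * x ^ 2 ≤ M * x) : x ≤ M / k := by
  rcases hx.eq_or_lt with rfl | hpos
  · positivity
  · rw [le_div_iff₀ hk]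
    exact le_of_mul_le_mul_right (by linarith) hpos

theorem stmt_0
    {V Z : Type*} [NormedAddCommGroup V] [InnerProductSpace ℝ V] [CompleteSpace V]
    [NormedAddCommGroup Z] [InnerProductSpace ℝ Z] [CompleteSpace Z]
    (Cmin Cmax lam2 lamq Lam lampsi : ℝ)
    (hCmin : 0 < Cmin) (hCmax : 0 ≤ Cmax) (hlam2 : 0 ≤ lam2)
    (hlamq : 0 ≤ lamq) (hLam : 0 ≤ Lam) (hlampsi : 0 ≤ lampsi)
    (a : V →ₗ[ℝ] V →ₗ[ℝ] ℝ) (e : Z →ₗ[ℝ] Z →ₗ[ℝ] ℝ)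
    (c : V →ₗ[ℝ] V →ₗ[ℝ] V →ₗ[ℝ] ℝ) (h : V →ₗ[ℝ] Z →ₗ[ℝ] Z →ₗ[ℝ] ℝ)
    (Q : Z →ₗ[ℝ] V →ₗ[ℝ] ℝ) (L : V →ₗ[ℝ] ℝ) (Ψ : Z →ₗ[ℝ] ℝ)
    (ha_bdd : ∀ u v : V, |a u v| ≤ Cmax * ‖u‖ * ‖v‖)
    (ha_coer : ∀ v : V, Cmin * ‖v‖ ^ 2 ≤ a v v)
    (he_bdd : ∀ θ r : Z, |e θ r| ≤ ‖θ‖ * ‖r‖)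
    (he_coer : ∀ r : Z, ‖r‖ ^ 2 ≤ e r r)
    (hc_bdd : ∀ w u v : V, |c w u v| ≤ lam2 * ‖w‖ * ‖u‖ * ‖v‖)
    (hc_skew : ∀ w v : V, c w v v = 0)
    (hh_bdd : ∀ (w : V) (θ r : Z), |h w θ r| ≤ lam2 * ‖w‖ * ‖θ‖ * ‖r‖)
    (hh_skew : ∀ (w : V) (r : Z), h w r r = 0)
    (hQ_bdd : ∀ (θ : Z) (v : V), |Q θ v| ≤ lamq * ‖θ‖ * ‖v‖)
    (hL_bdd : ∀ v : V, |L v| ≤ Lam * ‖v‖)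
    (hPsi_bdd : ∀ r : Z, |Ψ r| ≤ lampsi * ‖r‖)
    (u : V) (θ : Z)
    (hu : ∀ v : V, a u v + c u u v + Q θ v = L v)
    (hθ : ∀ r : Z, e θ r + h u θ r = Ψ r) :
    ‖θ‖ ≤ lampsi ∧ ‖u‖ ≤ ((Lam + lamq * lampsi) / Cmin) := by
  have hθ_norm : ‖θ‖ ≤ lampsi := by
    have he_eq := hθ θ
    rw [hh_skew, add_zero] at he_eq
    have hsq : 1 * ‖θ‖ ^ 2 ≤ lampsi * ‖θ‖ := by
      linarith [he_coer θ, le_abs_self (Ψ θ), hPsi_bdd θ]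
    simpa using le_div_of_mul_sq_le_mul one_pos hlampsi (norm_nonneg θ) hsq
  refine ⟨hθ_norm, ?_⟩
  have ha_eq := hu u
  rw [hc_skew, add_zero] at ha_eq
  have hQ_le : lamq * ‖θ‖ * ‖u‖ ≤ lamq * lampsi * ‖u‖ := by gcongr
  refine le_div_of_mul_sq_le_mul hCmin (by positivity) (norm_nonneg u) ?_
  linarith [ha_coer u, le_abs_self (L u), hL_bdd u, neg_abs_le (Q θ u), hQ_bdd θ u]
end

section
/- In the abstract framework, if w₁, w₂ ∈ V and θ₁, θ₂ ∈ Z satisfy e(θᵢ,r) + h(wᵢ,θᵢ,r) = Ψ(r) for all r ∈ Z (i = 1, 2), then ‖θ₁ − θ₂‖ ≤ λ₂·λ_ψ·‖w₁ − w₂‖; that is, the solution map of the temperature subproblem is Lipschitz with constant λ₂λ_ψ. -/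
theorem le_of_sq_le_mul_self {x K : ℝ} (hK : 0 ≤ K) (h : x ^ 2 ≤ K * x) : x ≤ K := by
  by_contra! hlt
  nlinarith [mul_pos (sub_pos.2 hlt) (hK.trans_lt hlt)]

theorem stmt_2
    {V Z : Type*} [NormedAddCommGroup V] [InnerProductSpace ℝ V] [CompleteSpace V]
    [NormedAddCommGroup Z] [InnerProductSpace ℝ Z] [CompleteSpace Z]
    (Cmin Cmax lam2 lamq Lam lampsi : ℝ)
    (hCmin : 0 < Cmin) (hCmax : 0 ≤ Cmax) (hlam2 : 0 ≤ lam2)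
    (hlamq : 0 ≤ lamq) (hLam : 0 ≤ Lam) (hlampsi : 0 ≤ lampsi)
    (a : V →ₗ[ℝ] V →ₗ[ℝ] ℝ) (e : Z →ₗ[ℝ] Z →ₗ[ℝ] ℝ)
    (c : V →ₗ[ℝ] V →ₗ[ℝ] V →ₗ[ℝ] ℝ) (h : V →ₗ[ℝ] Z →ₗ[ℝ] Z →ₗ[ℝ] ℝ)
    (Q : Z →ₗ[ℝ] V →ₗ[ℝ] ℝ) (L : V →ₗ[ℝ] ℝ) (Ψ : Z →ₗ[ℝ] ℝ)
    (ha_bdd : ∀ u v : V, |a u v| ≤ Cmax * ‖u‖ * ‖v‖)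
    (ha_coer : ∀ v : V, Cmin * ‖v‖ ^ 2 ≤ a v v)
    (he_bdd : ∀ θ r : Z, |e θ r| ≤ ‖θ‖ * ‖r‖)
    (he_coer : ∀ r : Z, ‖r‖ ^ 2 ≤ e r r)
    (hc_bdd : ∀ w u v : V, |c w u v| ≤ lam2 * ‖w‖ * ‖u‖ * ‖v‖)
    (hc_skew : ∀ w v : V, c w v v = 0)
    (hh_bdd : ∀ (w : V) (θ r : Z), |h w θ r| ≤ lam2 * ‖w‖ * ‖θ‖ * ‖r‖)
    (hh_skew : ∀ (w : V) (r : Z), h w r r = 0)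
    (hQ_bdd : ∀ (θ : Z) (v : V), |Q θ v| ≤ lamq * ‖θ‖ * ‖v‖)
    (hL_bdd : ∀ v : V, |L v| ≤ Lam * ‖v‖)
    (hPsi_bdd : ∀ r : Z, |Ψ r| ≤ lampsi * ‖r‖)
    (w₁ w₂ : V) (θ₁ θ₂ : Z)
    (h1 : ∀ r : Z, e θ₁ r + h w₁ θ₁ r = Ψ r)
    (h2 : ∀ r : Z, e θ₂ r + h w₂ θ₂ r = Ψ r) :
    ‖θ₁ - θ₂‖ ≤ lam2 * lampsi * ‖w₁ - w₂‖ := by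
  have norm_θ₂ : ‖θ₂‖ ≤ lampsi := by
    refine le_of_sq_le_mul_self hlampsi ?_
    have energy := h2 θ₂
    rw [hh_skew, add_zero] at energy
    exact (he_coer θ₂).trans (energy.trans_le ((le_abs_self _).trans (hPsi_bdd θ₂)))
  refine le_of_sq_le_mul_self (by positivity) ?_
  have error_eq : e (θ₁ - θ₂) (θ₁ - θ₂) = -h (w₁ - w₂) θ₂ (θ₁ - θ₂) := by
    have skew : h w₁ θ₁ (θ₁ - θ₂) - h w₁ θ₂ (θ₁ - θ₂) = 0 := by
      rw [← LinearMap.sub_apply, ← map_sub, hh_skew]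
    rw [map_sub e, map_sub h]
    simp only [LinearMap.sub_apply]
    linarith [h1 (θ₁ - θ₂), h2 (θ₁ - θ₂)]
  calc ‖θ₁ - θ₂‖ ^ 2 ≤ -h (w₁ - w₂) θ₂ (θ₁ - θ₂) := (he_coer _).trans_eq error_eq
    _ ≤ lam2 * ‖w₁ - w₂‖ * ‖θ₂‖ * ‖θ₁ - θ₂‖ := (neg_le_abs _).trans (hh_bdd _ _ _)
    _ ≤ lam2 * ‖w₁ - w₂‖ * lampsi * ‖θ₁ - θ₂‖ := by gcongr
    _ = lam2 * lampsi * ‖w₁ - w₂‖ * ‖θ₁ - θ₂‖ := by ring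
end

section
/- In the abstract framework, suppose for i = 1, 2 that wᵢ ∈ V, θᵢ ∈ Z and uᵢ ∈ V satisfy e(θᵢ,r) + h(wᵢ,θᵢ,r) = Ψ(r) for all r ∈ Z and a(uᵢ,v) + c(wᵢ,uᵢ,v) + Q(θᵢ,v) = L(v) for all v ∈ V, and suppose ‖u₂‖ ≤ C₀. Then ‖u₁ − u₂‖ ≤ σ·‖w₁ − w₂‖; in particular, if σ < 1 the fixed-point map w ↦ u of the paper is a contraction. -/
/-- A quadratic lower bound against a linear upper bound lets one factor cancel. -/
theorem mul_le_of_mul_sq_le_mul {k M x : ℝ} (hx : 0 ≤ x) (hM : 0 ≤ M)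
    (hkM : k * x ^ 2 ≤ M * x) : k * x ≤ M := by
  rcases hx.eq_or_lt with rfl | hx
  · simpa using hM
  · exact le_of_mul_le_mul_right (by linarith) hx

theorem stmt_4
    {V Z : Type*} [NormedAddCommGroup V] [InnerProductSpace ℝ V] [CompleteSpace V]
    [NormedAddCommGroup Z] [InnerProductSpace ℝ Z] [CompleteSpace Z]
    (Cmin Cmax lam2 lamq Lam lampsi : ℝ)
    (hCmin : 0 < Cmin) (hCmax : 0 ≤ Cmax) (hlam2 : 0 ≤ lam2)
    (hlamq : 0 ≤ lamq) (hLam : 0 ≤ Lam) (hlampsi : 0 ≤ lampsi)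
    (a : V →ₗ[ℝ] V →ₗ[ℝ] ℝ) (e : Z →ₗ[ℝ] Z →ₗ[ℝ] ℝ)
    (c : V →ₗ[ℝ] V →ₗ[ℝ] V →ₗ[ℝ] ℝ) (h : V →ₗ[ℝ] Z →ₗ[ℝ] Z →ₗ[ℝ] ℝ)
    (Q : Z →ₗ[ℝ] V →ₗ[ℝ] ℝ) (L : V →ₗ[ℝ] ℝ) (Ψ : Z →ₗ[ℝ] ℝ)
    (ha_bdd : ∀ u v : V, |a u v| ≤ Cmax * ‖u‖ * ‖v‖)
    (ha_coer : ∀ v : V, Cmin * ‖v‖ ^ 2 ≤ a v v)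
    (he_bdd : ∀ θ r : Z, |e θ r| ≤ ‖θ‖ * ‖r‖)
    (he_coer : ∀ r : Z, ‖r‖ ^ 2 ≤ e r r)
    (hc_bdd : ∀ w u v : V, |c w u v| ≤ lam2 * ‖w‖ * ‖u‖ * ‖v‖)
    (hc_skew : ∀ w v : V, c w v v = 0)
    (hh_bdd : ∀ (w : V) (θ r : Z), |h w θ r| ≤ lam2 * ‖w‖ * ‖θ‖ * ‖r‖)
    (hh_skew : ∀ (w : V) (r : Z), h w r r = 0)
    (hQ_bdd : ∀ (θ : Z) (v : V), |Q θ v| ≤ lamq * ‖θ‖ * ‖v‖)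
    (hL_bdd : ∀ v : V, |L v| ≤ Lam * ‖v‖)
    (hPsi_bdd : ∀ r : Z, |Ψ r| ≤ lampsi * ‖r‖)
    (w₁ w₂ u₁ u₂ : V) (θ₁ θ₂ : Z)
    (hθ1 : ∀ r : Z, e θ₁ r + h w₁ θ₁ r = Ψ r)
    (hθ2 : ∀ r : Z, e θ₂ r + h w₂ θ₂ r = Ψ r)
    (hu1 : ∀ v : V, a u₁ v + c w₁ u₁ v + Q θ₁ v = L v)
    (hu2 : ∀ v : V, a u₂ v + c w₂ u₂ v + Q θ₂ v = L v)
    (hu2bdd : ‖u₂‖ ≤ ((Lam + lamq * lampsi) / Cmin)) :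
    ‖u₁ - u₂‖ ≤ (lam2 * Lam / Cmin ^ 2 + lam2 * lamq * lampsi / Cmin ^ 2 + lam2 * lamq * lampsi / Cmin + lam2 * Lam / Cmin) * ‖w₁ - w₂‖ := by
  have hθ₂ : ‖θ₂‖ ≤ lampsi := by
    have key : 1 * ‖θ₂‖ ^ 2 ≤ lampsi * ‖θ₂‖ := by
      have hΨ := (abs_le.mp (hPsi_bdd θ₂)).2
      linarith [he_coer θ₂, hθ2 θ₂, hh_skew w₂ θ₂]
    simpa using mul_le_of_mul_sq_le_mul (norm_nonneg _) hlampsi key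
  have hθ : ‖θ₁ - θ₂‖ ≤ lam2 * ‖w₁ - w₂‖ * lampsi := by
    have energy : e (θ₁ - θ₂) (θ₁ - θ₂) = -h (w₁ - w₂) θ₂ (θ₁ - θ₂) := by
      have hskew := hh_skew w₁ (θ₁ - θ₂)
      have hdiff := (hθ1 (θ₁ - θ₂)).trans (hθ2 (θ₁ - θ₂)).symm
      simp only [map_sub, LinearMap.sub_apply] at hskew hdiff ⊢
      linarith
    have key : 1 * ‖θ₁ - θ₂‖ ^ 2 ≤ lam2 * ‖w₁ - w₂‖ * ‖θ₂‖ * ‖θ₁ - θ₂‖ := by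
      have hconv := (abs_le.mp (hh_bdd (w₁ - w₂) θ₂ (θ₁ - θ₂))).1
      linarith [he_coer (θ₁ - θ₂)]
    calc ‖θ₁ - θ₂‖ = 1 * ‖θ₁ - θ₂‖ := (one_mul _).symm
      _ ≤ lam2 * ‖w₁ - w₂‖ * ‖θ₂‖ :=
        mul_le_of_mul_sq_le_mul (norm_nonneg _) (by positivity) key
      _ ≤ lam2 * ‖w₁ - w₂‖ * lampsi := by gcongr
  have hu : Cmin * ‖u₁ - u₂‖ ≤ lam2 * ‖w₁ - w₂‖ * ‖u₂‖ + lamq * ‖θ₁ - θ₂‖ := by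
    have energy : a (u₁ - u₂) (u₁ - u₂) =
        -c (w₁ - w₂) u₂ (u₁ - u₂) - Q (θ₁ - θ₂) (u₁ - u₂) := by
      have hskew := hc_skew w₁ (u₁ - u₂)
      have hdiff := (hu1 (u₁ - u₂)).trans (hu2 (u₁ - u₂)).symm
      simp only [map_sub, LinearMap.sub_apply] at hskew hdiff ⊢
      linarith
    refine mul_le_of_mul_sq_le_mul (norm_nonneg _) (by positivity) ?_
    have hconv := (abs_le.mp (hc_bdd (w₁ - w₂) u₂ (u₁ - u₂))).1
    have hbuoy := (abs_le.mp (hQ_bdd (θ₁ - θ₂) (u₁ - u₂))).1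
    linarith [ha_coer (u₁ - u₂)]
  have hu' : Cmin * ‖u₁ - u₂‖ ≤ lam2 * ‖w₁ - w₂‖ * ((Lam + lamq * lampsi) / Cmin) +
      lamq * (lam2 * ‖w₁ - w₂‖ * lampsi) := hu.trans (by gcongr)
  calc ‖u₁ - u₂‖ ≤ (lam2 * ‖w₁ - w₂‖ * ((Lam + lamq * lampsi) / Cmin) +
        lamq * (lam2 * ‖w₁ - w₂‖ * lampsi)) / Cmin := by
        rw [le_div_iff₀ hCmin]
        linarith
    _ = (lam2 * Lam / Cmin ^ 2 + lam2 * lamq * lampsi / Cmin ^ 2 +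
        lam2 * lamq * lampsi / Cmin) * ‖w₁ - w₂‖ := by
        field_simp
    _ ≤ _ := by
        exact mul_le_mul_of_nonneg_right (le_add_of_nonneg_right (by positivity)) (norm_nonneg _)
end

section
/- In the abstract framework, if σ < 1 then the coupled problem has a solution: there exist u ∈ V and θ ∈ Z with a(u,v) + c(u,u,v) + Q(θ,v) = L(v) for all v ∈ V and e(θ,r) + h(u,θ,r) = Ψ(r) for all r ∈ Z, satisfying ‖u‖ ≤ C₀ and ‖θ‖ ≤ λ_ψ. (Existence part of Theorem 2.3 of the paper, proved by the Banach fixed point theorem.) -/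
/-- The Lax–Milgram theorem for an algebraic bilinear form that is bounded and coercive. -/
theorem exists_bilin_eq_of_coercive {E : Type*} [NormedAddCommGroup E] [InnerProductSpace ℝ E]
    [CompleteSpace E] (B : E →ₗ[ℝ] E →ₗ[ℝ] ℝ) (F : E →ₗ[ℝ] ℝ) {M N m : ℝ} (hm : 0 < m)
    (hB : ∀ x y, |B x y| ≤ M * ‖x‖ * ‖y‖) (hcoer : ∀ x, m * ‖x‖ ^ 2 ≤ B x x)
    (hF : ∀ x, |F x| ≤ N * ‖x‖) : ∃ x, ∀ y, B x y = F y := by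
  have hco : IsCoercive (B.mkContinuous₂ M hB) :=
    ⟨m, hm, fun x => by simpa [pow_two, mul_assoc] using hcoer x⟩
  refine ⟨hco.continuousLinearEquivOfBilin.symm
    ((InnerProductSpace.toDual ℝ E).symm (F.mkContinuous N hF)), fun y => ?_⟩
  have key := hco.continuousLinearEquivOfBilin_apply (hco.continuousLinearEquivOfBilin.symm
    ((InnerProductSpace.toDual ℝ E).symm (F.mkContinuous N hF))) y
  rw [ContinuousLinearEquiv.apply_symm_apply, InnerProductSpace.toDual_symm_apply] at key
  simpa using key.symm

theorem mul_norm_le_of_mul_norm_sq_le {E : Type*} [NormedAddCommGroup E] {m N : ℝ} (hN : 0 ≤ N)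
    {x : E} (h : m * ‖x‖ ^ 2 ≤ N * ‖x‖) : m * ‖x‖ ≤ N := by
  rcases (norm_nonneg x).eq_or_lt with hx | hx
  · simpa [← hx] using hN
  · exact le_of_mul_le_mul_right (by linarith [h, pow_two ‖x‖, mul_assoc m ‖x‖ ‖x‖]) hx

/-- A solution of the linearised equation `B x + T w x = F` exists when `T w` is skew, and it
satisfies the same a priori estimate as for `T = 0`. -/
theorem exists_bilin_add_skew_eq {W E : Type*} [NormedAddCommGroup W] [InnerProductSpace ℝ W]
    [NormedAddCommGroup E] [InnerProductSpace ℝ E] [CompleteSpace E]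
    (B : E →ₗ[ℝ] E →ₗ[ℝ] ℝ) (T : W →ₗ[ℝ] E →ₗ[ℝ] E →ₗ[ℝ] ℝ) (F : E →ₗ[ℝ] ℝ) {M N m l : ℝ}
    (hm : 0 < m) (hN : 0 ≤ N)
    (hB : ∀ x y, |B x y| ≤ M * ‖x‖ * ‖y‖) (hcoer : ∀ x, m * ‖x‖ ^ 2 ≤ B x x)
    (hT : ∀ w x y, |T w x y| ≤ l * ‖w‖ * ‖x‖ * ‖y‖) (hskew : ∀ w x, T w x x = 0)
    (hF : ∀ x, |F x| ≤ N * ‖x‖) (w : W) :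
    ∃ x, (∀ y, B x y + T w x y = F y) ∧ m * ‖x‖ ≤ N := by
  obtain ⟨x, hx⟩ := exists_bilin_eq_of_coercive (B + T w) F (M := M + l * ‖w‖) (N := N) hm
    (fun x y => by
      have := abs_add_le (B x y) (T w x y)
      simp only [LinearMap.add_apply]
      linarith [hB x y, hT w x y])
    (fun x => by simpa [hskew] using hcoer x) hF
  refine ⟨x, fun y => by simpa using hx y, mul_norm_le_of_mul_norm_sq_le hN ?_⟩
  have hxx : B x x = F x := by simpa [hskew] using hx x
  linarith [hcoer x, le_abs_self (F x), hF x]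

/-- Stability of the linearised equation with respect to the advecting field and the data. -/
theorem mul_norm_sub_le_of_bilin_add_skew_eq {W E : Type*} [NormedAddCommGroup W]
    [InnerProductSpace ℝ W] [NormedAddCommGroup E] [InnerProductSpace ℝ E]
    (B : E →ₗ[ℝ] E →ₗ[ℝ] ℝ) (T : W →ₗ[ℝ] E →ₗ[ℝ] E →ₗ[ℝ] ℝ) {F₁ F₂ : E →ₗ[ℝ] ℝ} {m l N : ℝ}
    (hl : 0 ≤ l) (hN : 0 ≤ N) (hcoer : ∀ x, m * ‖x‖ ^ 2 ≤ B x x)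
    (hT : ∀ w x y, |T w x y| ≤ l * ‖w‖ * ‖x‖ * ‖y‖) (hskew : ∀ w x, T w x x = 0)
    (hF : ∀ y, |F₁ y - F₂ y| ≤ N * ‖y‖) {w₁ w₂ : W} {x₁ x₂ : E}
    (h₁ : ∀ y, B x₁ y + T w₁ x₁ y = F₁ y) (h₂ : ∀ y, B x₂ y + T w₂ x₂ y = F₂ y) :
    m * ‖x₁ - x₂‖ ≤ l * ‖w₁ - w₂‖ * ‖x₂‖ + N := by
  refine mul_norm_le_of_mul_norm_sq_le (by positivity) ?_
  have hc := hcoer (x₁ - x₂)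
  have ht := (abs_le.mp (hT (w₁ - w₂) x₂ (x₁ - x₂))).1
  have hf := (abs_le.mp (hF (x₁ - x₂))).2
  have hs := hskew w₁ (x₁ - x₂)
  have e₁ := h₁ (x₁ - x₂)
  have e₂ := h₂ (x₁ - x₂)
  simp only [map_sub, LinearMap.sub_apply] at hc ht hf hs e₁ e₂
  linarith


theorem stmt_5
    {V Z : Type*} [NormedAddCommGroup V] [InnerProductSpace ℝ V] [CompleteSpace V]
    [NormedAddCommGroup Z] [InnerProductSpace ℝ Z] [CompleteSpace Z]
    (Cmin Cmax lam2 lamq Lam lampsi : ℝ)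
    (hCmin : 0 < Cmin) (hCmax : 0 ≤ Cmax) (hlam2 : 0 ≤ lam2)
    (hlamq : 0 ≤ lamq) (hLam : 0 ≤ Lam) (hlampsi : 0 ≤ lampsi)
    (a : V →ₗ[ℝ] V →ₗ[ℝ] ℝ) (e : Z →ₗ[ℝ] Z →ₗ[ℝ] ℝ)
    (c : V →ₗ[ℝ] V →ₗ[ℝ] V →ₗ[ℝ] ℝ) (h : V →ₗ[ℝ] Z →ₗ[ℝ] Z →ₗ[ℝ] ℝ)
    (Q : Z →ₗ[ℝ] V →ₗ[ℝ] ℝ) (L : V →ₗ[ℝ] ℝ) (Ψ : Z →ₗ[ℝ] ℝ)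
    (ha_bdd : ∀ u v : V, |a u v| ≤ Cmax * ‖u‖ * ‖v‖)
    (ha_coer : ∀ v : V, Cmin * ‖v‖ ^ 2 ≤ a v v)
    (he_bdd : ∀ θ r : Z, |e θ r| ≤ ‖θ‖ * ‖r‖)
    (he_coer : ∀ r : Z, ‖r‖ ^ 2 ≤ e r r)
    (hc_bdd : ∀ w u v : V, |c w u v| ≤ lam2 * ‖w‖ * ‖u‖ * ‖v‖)
    (hc_skew : ∀ w v : V, c w v v = 0)
    (hh_bdd : ∀ (w : V) (θ r : Z), |h w θ r| ≤ lam2 * ‖w‖ * ‖θ‖ * ‖r‖)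
    (hh_skew : ∀ (w : V) (r : Z), h w r r = 0)
    (hQ_bdd : ∀ (θ : Z) (v : V), |Q θ v| ≤ lamq * ‖θ‖ * ‖v‖)
    (hL_bdd : ∀ v : V, |L v| ≤ Lam * ‖v‖)
    (hPsi_bdd : ∀ r : Z, |Ψ r| ≤ lampsi * ‖r‖)
    (hsigma : (lam2 * Lam / Cmin ^ 2 + lam2 * lamq * lampsi / Cmin ^ 2 + lam2 * lamq * lampsi / Cmin + lam2 * Lam / Cmin) < 1) :
    ∃ (u : V) (θ : Z),
      (∀ v : V, a u v + c u u v + Q θ v = L v) ∧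
      (∀ r : Z, e θ r + h u θ r = Ψ r) ∧
      ‖u‖ ≤ ((Lam + lamq * lampsi) / Cmin) ∧ ‖θ‖ ≤ lampsi := by
  choose Θ hΘ hΘ_le using exists_bilin_add_skew_eq e h Ψ (M := 1) one_pos hlampsi
    (by simpa using he_bdd) (by simpa using he_coer) hh_bdd hh_skew hPsi_bdd
  simp only [one_mul] at hΘ_le
  have hQΘ (w v : V) : |Q (Θ w) v| ≤ lamq * lampsi * ‖v‖ :=
    (hQ_bdd _ _).trans (by gcongr; exact hΘ_le w)
  choose U hU hU_le using fun w => exists_bilin_add_skew_eq a c (L - Q (Θ w))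
    (N := Lam + lamq * lampsi) hCmin (by positivity) ha_bdd ha_coer hc_bdd hc_skew
    (fun v => by
      have := abs_sub (L v) (Q (Θ w) v)
      simp only [LinearMap.sub_apply]
      linarith [hL_bdd v, hQΘ w v]) w
  have hU_le' (w : V) : ‖U w‖ ≤ (Lam + lamq * lampsi) / Cmin := by
    rw [le_div_iff₀' hCmin]
    exact hU_le w
  have hΘ_lip (w₁ w₂ : V) : ‖Θ w₁ - Θ w₂‖ ≤ lam2 * ‖w₁ - w₂‖ * lampsi := by
    have := mul_norm_sub_le_of_bilin_add_skew_eq e h (m := 1) (N := 0) hlam2 le_rfl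
      (by simpa using he_coer) hh_bdd hh_skew (by simp) (hΘ w₁) (hΘ w₂)
    rw [one_mul, add_zero] at this
    exact this.trans (by gcongr; exact hΘ_le w₂)
  set k : ℝ := lam2 * Lam / Cmin ^ 2 + lam2 * lamq * lampsi / Cmin ^ 2
    + lam2 * lamq * lampsi / Cmin with hk
  have hk0 : 0 ≤ k := by positivity
  have hk1 : k < 1 := by
    have : 0 ≤ lam2 * Lam / Cmin := by positivity
    linarith
  have hU_lip (w₁ w₂ : V) : ‖U w₁ - U w₂‖ ≤ k * ‖w₁ - w₂‖ := by
    have hstab := mul_norm_sub_le_of_bilin_add_skew_eq a c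
      (N := lamq * (lam2 * ‖w₁ - w₂‖ * lampsi)) hlam2 (by positivity) ha_coer hc_bdd hc_skew
      (fun v => by
        have := hQ_bdd (Θ w₁ - Θ w₂) v
        rw [map_sub, LinearMap.sub_apply, abs_sub_comm] at this
        simp only [LinearMap.sub_apply, sub_sub_sub_cancel_left]
        exact this.trans (by gcongr; exact hΘ_lip w₁ w₂)) (hU w₁) (hU w₂)
    refine le_of_mul_le_mul_left ?_ hCmin
    calc Cmin * ‖U w₁ - U w₂‖
        ≤ lam2 * ‖w₁ - w₂‖ * ‖U w₂‖ + lamq * (lam2 * ‖w₁ - w₂‖ * lampsi) := hstab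
      _ ≤ lam2 * ‖w₁ - w₂‖ * ((Lam + lamq * lampsi) / Cmin)
          + lamq * (lam2 * ‖w₁ - w₂‖ * lampsi) := by gcongr; exact hU_le' w₂
      _ = Cmin * (k * ‖w₁ - w₂‖) := by rw [hk]; field_simp
  have hcontr : ContractingWith ⟨k, hk0⟩ U :=
    ⟨hk1, LipschitzWith.of_dist_le_mul fun x y => by
      rw [dist_eq_norm, dist_eq_norm]
      exact hU_lip x y⟩
  have hfix : U (hcontr.fixedPoint U) = hcontr.fixedPoint U := hcontr.fixedPoint_isFixedPt
  set u := hcontr.fixedPoint U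
  refine ⟨u, Θ u, fun v => ?_, hΘ u, ?_, hΘ_le u⟩
  · have := hU u v
    rw [hfix, LinearMap.sub_apply] at this
    linarith
  · simpa only [hfix] using hU_le' u
end

section
/- In the abstract framework, suppose (u, θ) ∈ V × Z solves the coupled problem, and suppose θ⁰ ∈ Z and u⁰ ∈ V satisfy e(θ⁰,r) = Ψ(r) for all r ∈ Z and a(u⁰,v) + Q(θ⁰,v) = L(v) for all v ∈ V. Then ‖θ − θ⁰‖ ≤ σ·λ_ψ and ‖u − u⁰‖ ≤ σ·C₀. (Initial-iterate error bounds of Lemma 4.1 of the paper.) -/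
theorem mul_le_of_mul_sq_le_mul_s8 {c x b : ℝ} (hx : 0 ≤ x) (hb : 0 ≤ b)
    (hle : c * x ^ 2 ≤ b * x) : c * x ≤ b := by
  rcases hx.eq_or_lt with rfl | hpos
  · simpa using hb
  · exact le_of_mul_le_mul_right (by linarith [sq x, mul_assoc c x x]) hpos

theorem stmt_8
    {V Z : Type*} [NormedAddCommGroup V] [InnerProductSpace ℝ V] [CompleteSpace V]
    [NormedAddCommGroup Z] [InnerProductSpace ℝ Z] [CompleteSpace Z]
    (Cmin Cmax lam2 lamq Lam lampsi : ℝ)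
    (hCmin : 0 < Cmin) (hCmax : 0 ≤ Cmax) (hlam2 : 0 ≤ lam2)
    (hlamq : 0 ≤ lamq) (hLam : 0 ≤ Lam) (hlampsi : 0 ≤ lampsi)
    (a : V →ₗ[ℝ] V →ₗ[ℝ] ℝ) (e : Z →ₗ[ℝ] Z →ₗ[ℝ] ℝ)
    (c : V →ₗ[ℝ] V →ₗ[ℝ] V →ₗ[ℝ] ℝ) (h : V →ₗ[ℝ] Z →ₗ[ℝ] Z →ₗ[ℝ] ℝ)
    (Q : Z →ₗ[ℝ] V →ₗ[ℝ] ℝ) (L : V →ₗ[ℝ] ℝ) (Ψ : Z →ₗ[ℝ] ℝ)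
    (ha_bdd : ∀ u v : V, |a u v| ≤ Cmax * ‖u‖ * ‖v‖)
    (ha_coer : ∀ v : V, Cmin * ‖v‖ ^ 2 ≤ a v v)
    (he_bdd : ∀ θ r : Z, |e θ r| ≤ ‖θ‖ * ‖r‖)
    (he_coer : ∀ r : Z, ‖r‖ ^ 2 ≤ e r r)
    (hc_bdd : ∀ w u v : V, |c w u v| ≤ lam2 * ‖w‖ * ‖u‖ * ‖v‖)
    (hc_skew : ∀ w v : V, c w v v = 0)
    (hh_bdd : ∀ (w : V) (θ r : Z), |h w θ r| ≤ lam2 * ‖w‖ * ‖θ‖ * ‖r‖)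
    (hh_skew : ∀ (w : V) (r : Z), h w r r = 0)
    (hQ_bdd : ∀ (θ : Z) (v : V), |Q θ v| ≤ lamq * ‖θ‖ * ‖v‖)
    (hL_bdd : ∀ v : V, |L v| ≤ Lam * ‖v‖)
    (hPsi_bdd : ∀ r : Z, |Ψ r| ≤ lampsi * ‖r‖)
    (u : V) (θ : Z)
    (hu : ∀ v : V, a u v + c u u v + Q θ v = L v)
    (hθ : ∀ r : Z, e θ r + h u θ r = Ψ r)
    (θ0 : Z) (u0 : V)
    (he0 : ∀ r : Z, e θ0 r = Ψ r)
    (hu0 : ∀ v : V, a u0 v + Q θ0 v = L v) :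
    ‖θ - θ0‖ ≤ (lam2 * Lam / Cmin ^ 2 + lam2 * lamq * lampsi / Cmin ^ 2 + lam2 * lamq * lampsi / Cmin + lam2 * Lam / Cmin) * lampsi ∧ ‖u - u0‖ ≤ (lam2 * Lam / Cmin ^ 2 + lam2 * lamq * lampsi / Cmin ^ 2 + lam2 * lamq * lampsi / Cmin + lam2 * Lam / Cmin) * ((Lam + lamq * lampsi) / Cmin) := by
  set C₀ := (Lam + lamq * lampsi) / Cmin with hC₀
  have hC₀_nonneg : 0 ≤ C₀ := by positivity
  have hθ_norm : ‖θ‖ ≤ lampsi := by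
    have key : 1 * ‖θ‖ ≤ lampsi := by
      refine mul_le_of_mul_sq_le_mul_s8 (norm_nonneg θ) hlampsi ?_
      linarith [he_coer θ, hθ θ, hh_skew u θ, le_of_abs_le (hPsi_bdd θ)]
    linarith
  have hu_norm : ‖u‖ ≤ C₀ := by
    rw [hC₀, le_div_iff₀' hCmin]
    refine mul_le_of_mul_sq_le_mul_s8 (norm_nonneg u) (by positivity) ?_
    have hQ : lamq * ‖θ‖ * ‖u‖ ≤ lamq * lampsi * ‖u‖ := by gcongr
    linarith [ha_coer u, hu u, hc_skew u u, le_of_abs_le (hL_bdd u),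
      neg_le_of_abs_le (hQ_bdd θ u)]
  have hθ_err : ‖θ - θ0‖ ≤ lam2 * C₀ * lampsi := by
    have key : 1 * ‖θ - θ0‖ ≤ lam2 * C₀ * lampsi := by
      refine mul_le_of_mul_sq_le_mul_s8 (norm_nonneg _) (by positivity) ?_
      have he : e (θ - θ0) (θ - θ0) = -h u θ (θ - θ0) := by
        rw [map_sub e, LinearMap.sub_apply]
        linarith [hθ (θ - θ0), he0 (θ - θ0)]
      have hh : lam2 * ‖u‖ * ‖θ‖ * ‖θ - θ0‖ ≤ lam2 * C₀ * lampsi * ‖θ - θ0‖ := by gcongr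
      linarith [he_coer (θ - θ0), neg_le_of_abs_le (hh_bdd u θ (θ - θ0))]
    linarith
  have hu_err : Cmin * ‖u - u0‖ ≤ lam2 * C₀ * C₀ + lamq * (lam2 * C₀ * lampsi) := by
    refine mul_le_of_mul_sq_le_mul_s8 (norm_nonneg _) (by positivity) ?_
    have ha : a (u - u0) (u - u0) = -c u u (u - u0) - Q (θ - θ0) (u - u0) := by
      rw [map_sub a, LinearMap.sub_apply, map_sub Q, LinearMap.sub_apply]
      linarith [hu (u - u0), hu0 (u - u0)]
    have hc : lam2 * ‖u‖ * ‖u‖ * ‖u - u0‖ ≤ lam2 * C₀ * C₀ * ‖u - u0‖ := by gcongr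
    have hQ : lamq * ‖θ - θ0‖ * ‖u - u0‖ ≤ lamq * (lam2 * C₀ * lampsi) * ‖u - u0‖ := by gcongr
    linarith [ha_coer (u - u0), neg_le_of_abs_le (hc_bdd u u (u - u0)),
      neg_le_of_abs_le (hQ_bdd (θ - θ0) (u - u0))]
  have hσ : lam2 * Lam / Cmin ^ 2 + lam2 * lamq * lampsi / Cmin ^ 2
      + lam2 * lamq * lampsi / Cmin + lam2 * Lam / Cmin = lam2 * C₀ / Cmin + lam2 * C₀ := by
    rw [hC₀]
    field_simp
    ring
  rw [hσ]
  constructor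
  · have : 0 ≤ lam2 * C₀ / Cmin * lampsi := by positivity
    linarith
  · refine le_of_mul_le_mul_left (hu_err.trans ?_) hCmin
    have hCC₀ : Cmin * C₀ = Lam + lamq * lampsi := by
      rw [hC₀]
      field_simp
    have hnonneg : 0 ≤ lam2 * C₀ * Lam := by positivity
    calc lam2 * C₀ * C₀ + lamq * (lam2 * C₀ * lampsi)
        ≤ lam2 * C₀ * C₀ + lam2 * C₀ * (Lam + lamq * lampsi) := by linarith
      _ = Cmin * ((lam2 * C₀ / Cmin + lam2 * C₀) * C₀) := by
        rw [← hCC₀]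
        field_simp
end

section
/- (Stability of the Stokes iteration.) In the abstract framework, let (uⁿ)ₙ≥₀ ⊆ V and (θⁿ)ₙ≥₀ ⊆ Z satisfy: e(θ⁰,r) = Ψ(r) for all r ∈ Z, a(u⁰,v) + Q(θ⁰,v) = L(v) for all v ∈ V, and for every n ≥ 1: a(uⁿ,v) + c(uⁿ⁻¹,uⁿ⁻¹,v) + Q(θⁿ,v) = L(v) for all v ∈ V and e(θⁿ,r) + h(uⁿ⁻¹,θⁿ⁻¹,r) = Ψ(r) for all r ∈ Z. If 0 < σ < 1/4, then for every n ≥ 0 one has ‖uⁿ‖ ≤ 2·C₀ and ‖θⁿ‖ ≤ 2·λ_ψ. -/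
theorem mul_norm_le_of_mul_norm_sq_le_s9 {E : Type*} [NormedAddCommGroup E] {k M : ℝ} {x : E}
    (hM : 0 ≤ M) (hx : k * ‖x‖ ^ 2 ≤ M * ‖x‖) : k * ‖x‖ ≤ M := by
  rcases (norm_nonneg x).eq_or_lt with h0 | hpos
  · simpa [← h0] using hM
  · refine le_of_mul_le_mul_right ?_ hpos
    linarith [show k * ‖x‖ * ‖x‖ = k * ‖x‖ ^ 2 by ring]


theorem stmt_9
    {V Z : Type*} [NormedAddCommGroup V] [InnerProductSpace ℝ V] [CompleteSpace V]
    [NormedAddCommGroup Z] [InnerProductSpace ℝ Z] [CompleteSpace Z]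
    (Cmin Cmax lam2 lamq Lam lampsi : ℝ)
    (hCmin : 0 < Cmin) (hCmax : 0 ≤ Cmax) (hlam2 : 0 ≤ lam2)
    (hlamq : 0 ≤ lamq) (hLam : 0 ≤ Lam) (hlampsi : 0 ≤ lampsi)
    (a : V →ₗ[ℝ] V →ₗ[ℝ] ℝ) (e : Z →ₗ[ℝ] Z →ₗ[ℝ] ℝ)
    (c : V →ₗ[ℝ] V →ₗ[ℝ] V →ₗ[ℝ] ℝ) (h : V →ₗ[ℝ] Z →ₗ[ℝ] Z →ₗ[ℝ] ℝ)
    (Q : Z →ₗ[ℝ] V →ₗ[ℝ] ℝ) (L : V →ₗ[ℝ] ℝ) (Ψ : Z →ₗ[ℝ] ℝ)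
    (ha_bdd : ∀ u v : V, |a u v| ≤ Cmax * ‖u‖ * ‖v‖)
    (ha_coer : ∀ v : V, Cmin * ‖v‖ ^ 2 ≤ a v v)
    (he_bdd : ∀ θ r : Z, |e θ r| ≤ ‖θ‖ * ‖r‖)
    (he_coer : ∀ r : Z, ‖r‖ ^ 2 ≤ e r r)
    (hc_bdd : ∀ w u v : V, |c w u v| ≤ lam2 * ‖w‖ * ‖u‖ * ‖v‖)
    (hc_skew : ∀ w v : V, c w v v = 0)
    (hh_bdd : ∀ (w : V) (θ r : Z), |h w θ r| ≤ lam2 * ‖w‖ * ‖θ‖ * ‖r‖)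
    (hh_skew : ∀ (w : V) (r : Z), h w r r = 0)
    (hQ_bdd : ∀ (θ : Z) (v : V), |Q θ v| ≤ lamq * ‖θ‖ * ‖v‖)
    (hL_bdd : ∀ v : V, |L v| ≤ Lam * ‖v‖)
    (hPsi_bdd : ∀ r : Z, |Ψ r| ≤ lampsi * ‖r‖)
    (un : ℕ → V) (θn : ℕ → Z)
    (h0e : ∀ r : Z, e (θn 0) r = Ψ r)
    (h0a : ∀ v : V, a (un 0) v + Q (θn 0) v = L v)
    (hstep_a : ∀ (n : ℕ) (v : V),
      a (un (n + 1)) v + c (un n) (un n) v + Q (θn (n + 1)) v = L v)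
    (hstep_e : ∀ (n : ℕ) (r : Z),
      e (θn (n + 1)) r + h (un n) (θn n) r = Ψ r)
    (hsig_pos : 0 < (lam2 * Lam / Cmin ^ 2 + lam2 * lamq * lampsi / Cmin ^ 2 + lam2 * lamq * lampsi / Cmin + lam2 * Lam / Cmin)) (hsig_lt : (lam2 * Lam / Cmin ^ 2 + lam2 * lamq * lampsi / Cmin ^ 2 + lam2 * lamq * lampsi / Cmin + lam2 * Lam / Cmin) < 1 / 4) :
    ∀ n : ℕ, ‖un n‖ ≤ 2 * ((Lam + lamq * lampsi) / Cmin) ∧ ‖θn n‖ ≤ 2 * lampsi := by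
  set C := (Lam + lamq * lampsi) / Cmin with hC
  have hC_nonneg : 0 ≤ C := by positivity
  have hCminC : Cmin * C = Lam + lamq * lampsi := by rw [hC]; field_simp
  have hsigma : lam2 * C / Cmin + lam2 * C < 1 / 4 := by
    refine lt_of_eq_of_lt ?_ hsig_lt
    rw [hC]; field_simp; ring
  have hsmall_div : 0 ≤ lam2 * C / Cmin := by positivity
  have hsmall : 0 ≤ lam2 * C := by positivity
  intro n
  induction n with
  | zero =>
    have hθ : 1 * ‖θn 0‖ ≤ lampsi := by
      refine mul_norm_le_of_mul_norm_sq_le_s9 hlampsi ?_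
      linarith [he_coer (θn 0), h0e (θn 0), (abs_le.mp (hPsi_bdd (θn 0))).2]
    have hu : Cmin * ‖un 0‖ ≤ Lam + lamq * ‖θn 0‖ := by
      refine mul_norm_le_of_mul_norm_sq_le_s9 (by positivity) ?_
      linarith [ha_coer (un 0), h0a (un 0), (abs_le.mp (hL_bdd (un 0))).2,
        (abs_le.mp (hQ_bdd (θn 0) (un 0))).1]
    have hQθ : lamq * ‖θn 0‖ ≤ lamq * lampsi := by gcongr; linarith
    refine ⟨le_of_mul_le_mul_left ?_ hCmin, by linarith⟩
    linarith [mul_nonneg hCmin.le hC_nonneg]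
  | succ n ih =>
    obtain ⟨hu_n, hθ_n⟩ := ih
    have hθ : 1 * ‖θn (n + 1)‖ ≤ lampsi + lam2 * ‖un n‖ * ‖θn n‖ := by
      refine mul_norm_le_of_mul_norm_sq_le_s9 (by positivity) ?_
      linarith [he_coer (θn (n + 1)), hstep_e n (θn (n + 1)),
        (abs_le.mp (hPsi_bdd (θn (n + 1)))).2,
        (abs_le.mp (hh_bdd (un n) (θn n) (θn (n + 1)))).1]
    have hu : Cmin * ‖un (n + 1)‖ ≤
        Lam + lam2 * ‖un n‖ * ‖un n‖ + lamq * ‖θn (n + 1)‖ := by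
      refine mul_norm_le_of_mul_norm_sq_le_s9 (by positivity) ?_
      linarith [ha_coer (un (n + 1)), hstep_a n (un (n + 1)),
        (abs_le.mp (hL_bdd (un (n + 1)))).2,
        (abs_le.mp (hc_bdd (un n) (un n) (un (n + 1)))).1,
        (abs_le.mp (hQ_bdd (θn (n + 1)) (un (n + 1)))).1]
    have hconv_θ : lam2 * ‖un n‖ * ‖θn n‖ ≤ lam2 * (2 * C) * (2 * lampsi) := by gcongr
    have hconv_u : lam2 * ‖un n‖ * ‖un n‖ ≤ lam2 * (2 * C) * (2 * C) := by gcongr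
    have hθ' : ‖θn (n + 1)‖ ≤ lampsi * (1 + 4 * (lam2 * C)) := by linarith
    have hQθ : lamq * ‖θn (n + 1)‖ ≤ lamq * (lampsi * (1 + 4 * (lam2 * C))) := by gcongr
    constructor
    · refine le_of_mul_le_mul_left ?_ hCmin
      have hquad : lam2 * (2 * C) * (2 * C) = 4 * (lam2 * C / Cmin) * (Cmin * C) := by
        field_simp; ring
      have hq : lamq * lampsi * (lam2 * C) ≤ Cmin * C * (lam2 * C) :=
        mul_le_mul_of_nonneg_right (by linarith) hsmall
      have hfactor : Cmin * C * (lam2 * C / Cmin + lam2 * C) ≤ Cmin * C * (1 / 4) := by gcongr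
      linarith
    · have hfactor : lampsi * (lam2 * C) ≤ lampsi * (1 / 4) := by gcongr; linarith
      linarith
end

section
/- (Convergence of the Stokes iteration.) In the abstract framework, let (u, θ) ∈ V × Z solve the coupled problem, and let (uⁿ)ₙ≥₀ ⊆ V and (θⁿ)ₙ≥₀ ⊆ Z satisfy: e(θ⁰,r) = Ψ(r) for all r ∈ Z, a(u⁰,v) + Q(θ⁰,v) = L(v) for all v ∈ V, and for every n ≥ 1: a(uⁿ,v) + c(uⁿ⁻¹,uⁿ⁻¹,v) + Q(θⁿ,v) = L(v) for all v ∈ V and e(θⁿ,r) + h(uⁿ⁻¹,θⁿ⁻¹,r) = Ψ(r) for all r ∈ Z. If 0 < σ < 1/4, then for every n ≥ 0 one has ‖u − uⁿ‖ ≤ (3σ)ⁿ·C₀ and ‖θ − θⁿ‖ ≤ (3σ)ⁿ·λ_ψ. -/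
/-- A coercivity bound against a linear bound in the norm controls the norm. -/
lemma norm_le_of_coercive_le {E : Type*} [NormedAddCommGroup E] {m M B : ℝ} {x : E}
    (hm : 0 < m) (hM : 0 ≤ M) (hcoer : m * ‖x‖ ^ 2 ≤ B) (hB : B ≤ M * ‖x‖) :
    ‖x‖ ≤ M / m := by
  rw [le_div_iff₀ hm]
  rcases (norm_nonneg x).eq_or_lt with hx | hx
  · simpa [← hx] using hM
  · refine le_of_mul_le_mul_right ?_ hx
    linarith [show ‖x‖ * m * ‖x‖ = m * ‖x‖ ^ 2 by ring]

/-- Perturbation estimate for a bounded trilinear form in its first two arguments. -/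
lemma abs_trilinear_sub_le {V Z : Type*} [NormedAddCommGroup V] [NormedSpace ℝ V]
    [NormedAddCommGroup Z] [NormedSpace ℝ Z] {l A B q : ℝ} (hl : 0 ≤ l)
    (h : V →ₗ[ℝ] Z →ₗ[ℝ] Z →ₗ[ℝ] ℝ)
    (hh : ∀ (w : V) (θ r : Z), |h w θ r| ≤ l * ‖w‖ * ‖θ‖ * ‖r‖)
    {u w : V} {θ t : Z} (hu : ‖u‖ ≤ A) (hθ : ‖θ‖ ≤ B) (hq : 0 ≤ q) (hq1 : q ≤ 1)
    (huw : ‖u - w‖ ≤ q * A) (hθt : ‖θ - t‖ ≤ q * B) (r : Z) :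
    |h w t r - h u θ r| ≤ 3 * q * (l * A * B) * ‖r‖ := by
  have hA : 0 ≤ A := (norm_nonneg _).trans hu
  have hB : 0 ≤ B := (norm_nonneg _).trans hθ
  have split : h w t r - h u θ r
      = h (u - w) (θ - t) r - h u (θ - t) r - h (u - w) θ r := by
    simp only [map_sub, LinearMap.sub_apply]
    ring
  have bound : ∀ {x : V} {y : Z} {α β : ℝ}, ‖x‖ ≤ α → ‖y‖ ≤ β →
      |h x y r| ≤ l * α * β * ‖r‖ := fun {x y α β} hx hy => by
    have hα : 0 ≤ α := (norm_nonneg _).trans hx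
    exact (hh x y r).trans (by gcongr)
  have h₁ := bound huw hθt
  have h₂ := bound hu hθt
  have h₃ := bound huw hθ
  have hqq : l * (q * A) * (q * B) * ‖r‖ ≤ q * (l * A * B * ‖r‖) := by
    have : q * q * (l * A * B * ‖r‖) ≤ q * (l * A * B * ‖r‖) := by
      gcongr
      exact mul_le_of_le_one_right hq hq1
    linarith
  rw [split, abs_le]
  rw [abs_le] at h₁ h₂ h₃
  constructor <;> linarith [h₁.1, h₁.2, h₂.1, h₂.2, h₃.1, h₃.2]

theorem stmt_10
    {V Z : Type*} [NormedAddCommGroup V] [InnerProductSpace ℝ V] [CompleteSpace V]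
    [NormedAddCommGroup Z] [InnerProductSpace ℝ Z] [CompleteSpace Z]
    (Cmin Cmax lam2 lamq Lam lampsi : ℝ)
    (hCmin : 0 < Cmin) (hCmax : 0 ≤ Cmax) (hlam2 : 0 ≤ lam2)
    (hlamq : 0 ≤ lamq) (hLam : 0 ≤ Lam) (hlampsi : 0 ≤ lampsi)
    (a : V →ₗ[ℝ] V →ₗ[ℝ] ℝ) (e : Z →ₗ[ℝ] Z →ₗ[ℝ] ℝ)
    (c : V →ₗ[ℝ] V →ₗ[ℝ] V →ₗ[ℝ] ℝ) (h : V →ₗ[ℝ] Z →ₗ[ℝ] Z →ₗ[ℝ] ℝ)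
    (Q : Z →ₗ[ℝ] V →ₗ[ℝ] ℝ) (L : V →ₗ[ℝ] ℝ) (Ψ : Z →ₗ[ℝ] ℝ)
    (ha_bdd : ∀ u v : V, |a u v| ≤ Cmax * ‖u‖ * ‖v‖)
    (ha_coer : ∀ v : V, Cmin * ‖v‖ ^ 2 ≤ a v v)
    (he_bdd : ∀ θ r : Z, |e θ r| ≤ ‖θ‖ * ‖r‖)
    (he_coer : ∀ r : Z, ‖r‖ ^ 2 ≤ e r r)
    (hc_bdd : ∀ w u v : V, |c w u v| ≤ lam2 * ‖w‖ * ‖u‖ * ‖v‖)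
    (hc_skew : ∀ w v : V, c w v v = 0)
    (hh_bdd : ∀ (w : V) (θ r : Z), |h w θ r| ≤ lam2 * ‖w‖ * ‖θ‖ * ‖r‖)
    (hh_skew : ∀ (w : V) (r : Z), h w r r = 0)
    (hQ_bdd : ∀ (θ : Z) (v : V), |Q θ v| ≤ lamq * ‖θ‖ * ‖v‖)
    (hL_bdd : ∀ v : V, |L v| ≤ Lam * ‖v‖)
    (hPsi_bdd : ∀ r : Z, |Ψ r| ≤ lampsi * ‖r‖)
    (u : V) (θ : Z)
    (hu : ∀ v : V, a u v + c u u v + Q θ v = L v)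
    (hθ : ∀ r : Z, e θ r + h u θ r = Ψ r)
    (un : ℕ → V) (θn : ℕ → Z)
    (h0e : ∀ r : Z, e (θn 0) r = Ψ r)
    (h0a : ∀ v : V, a (un 0) v + Q (θn 0) v = L v)
    (hstep_a : ∀ (n : ℕ) (v : V),
      a (un (n + 1)) v + c (un n) (un n) v + Q (θn (n + 1)) v = L v)
    (hstep_e : ∀ (n : ℕ) (r : Z),
      e (θn (n + 1)) r + h (un n) (θn n) r = Ψ r)
    (hsig_pos : 0 < (lam2 * Lam / Cmin ^ 2 + lam2 * lamq * lampsi / Cmin ^ 2 + lam2 * lamq * lampsi / Cmin + lam2 * Lam / Cmin)) (hsig_lt : (lam2 * Lam / Cmin ^ 2 + lam2 * lamq * lampsi / Cmin ^ 2 + lam2 * lamq * lampsi / Cmin + lam2 * Lam / Cmin) < 1 / 4) :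
    ∀ n : ℕ, ‖u - un n‖ ≤ (3 * (lam2 * Lam / Cmin ^ 2 + lam2 * lamq * lampsi / Cmin ^ 2 + lam2 * lamq * lampsi / Cmin + lam2 * Lam / Cmin)) ^ n * ((Lam + lamq * lampsi) / Cmin) ∧
      ‖θ - θn n‖ ≤ (3 * (lam2 * Lam / Cmin ^ 2 + lam2 * lamq * lampsi / Cmin ^ 2 + lam2 * lamq * lampsi / Cmin + lam2 * Lam / Cmin)) ^ n * lampsi := by
  set σ := lam2 * Lam / Cmin ^ 2 + lam2 * lamq * lampsi / Cmin ^ 2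
    + lam2 * lamq * lampsi / Cmin + lam2 * Lam / Cmin with hσ
  set C₀ := (Lam + lamq * lampsi) / Cmin with hC₀
  have hC₀_nonneg : 0 ≤ C₀ := by positivity
  have hC₀_mul : Cmin * C₀ = Lam + lamq * lampsi := by rw [hC₀]; field_simp
  have hσ_eq : σ = lam2 * C₀ / Cmin + lam2 * C₀ := by
    rw [hσ, hC₀]; field_simp; ring
  have hK_le : lam2 * C₀ ≤ σ := by
    rw [hσ_eq]; exact le_add_of_nonneg_left (by positivity)
  have hθ_norm : ‖θ‖ ≤ lampsi := by
    have hB : e θ θ ≤ lampsi * ‖θ‖ := by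
      linarith [hθ θ, hh_skew u θ, (abs_le.1 (hPsi_bdd θ)).2]
    simpa using norm_le_of_coercive_le one_pos hlampsi (by simpa using he_coer θ) hB
  have hu_norm : ‖u‖ ≤ C₀ := by
    refine norm_le_of_coercive_le hCmin (by positivity) (ha_coer u) ?_
    have hQ : lamq * ‖θ‖ * ‖u‖ ≤ lamq * lampsi * ‖u‖ := by gcongr
    linarith [hu u, hc_skew u u, (abs_le.1 (hL_bdd u)).2, (abs_le.1 (hQ_bdd θ u)).1]
  have step : ∀ (q : ℝ) (w u' : V) (t t' : Z), 0 ≤ q → q ≤ 1 →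
      ‖u - w‖ ≤ q * C₀ → ‖θ - t‖ ≤ q * lampsi →
      (∀ v, a u' v + c w w v + Q t' v = L v) → (∀ r, e t' r + h w t r = Ψ r) →
      ‖u - u'‖ ≤ 3 * σ * q * C₀ ∧ ‖θ - t'‖ ≤ 3 * σ * q * lampsi := by
    intro q w u' t t' hq hq1 huw hθt hu' ht'
    have hθ_err : ‖θ - t'‖ ≤ 3 * q * (lam2 * C₀ * lampsi) := by
      have hB : e (θ - t') (θ - t') ≤ 3 * q * (lam2 * C₀ * lampsi) * ‖θ - t'‖ := by
        have heq : e (θ - t') (θ - t') = h w t (θ - t') - h u θ (θ - t') := by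
          rw [map_sub e, LinearMap.sub_apply]
          linarith [hθ (θ - t'), ht' (θ - t')]
        rw [heq]
        exact (le_abs_self _).trans
          (abs_trilinear_sub_le hlam2 h hh_bdd hu_norm hθ_norm hq hq1 huw hθt _)
      simpa using norm_le_of_coercive_le one_pos (by positivity)
        (by simpa using he_coer (θ - t')) hB
    constructor
    · have hB : a (u - u') (u - u') ≤
          (3 * q * (lam2 * C₀ * C₀) + lamq * (3 * q * (lam2 * C₀ * lampsi))) * ‖u - u'‖ := by
        have heq : a (u - u') (u - u')
            = (c w w (u - u') - c u u (u - u')) - Q (θ - t') (u - u') := by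
          rw [map_sub a, map_sub Q, LinearMap.sub_apply, LinearMap.sub_apply]
          linarith [hu (u - u'), hu' (u - u')]
        have hc := (le_abs_self _).trans
          (abs_trilinear_sub_le hlam2 c hc_bdd hu_norm hu_norm hq hq1 huw huw (u - u'))
        have hQ : lamq * ‖θ - t'‖ * ‖u - u'‖ ≤
            lamq * (3 * q * (lam2 * C₀ * lampsi)) * ‖u - u'‖ := by gcongr
        rw [heq]
        linarith [(abs_le.1 (hQ_bdd (θ - t') (u - u'))).1]
      refine (norm_le_of_coercive_le hCmin (by positivity) (ha_coer _) hB).trans ?_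
      rw [div_le_iff₀ hCmin]
      have hp : lamq * lampsi ≤ Cmin * C₀ := by linarith
      have hσ_mul : σ * Cmin = lam2 * C₀ + lam2 * C₀ * Cmin := by
        rw [hσ_eq]; field_simp
      calc 3 * q * (lam2 * C₀ * C₀) + lamq * (3 * q * (lam2 * C₀ * lampsi))
          = 3 * q * (lam2 * C₀ * C₀) + 3 * q * (lam2 * C₀) * (lamq * lampsi) := by ring
        _ ≤ 3 * q * (lam2 * C₀ * C₀) + 3 * q * (lam2 * C₀) * (Cmin * C₀) := by gcongr
        _ = 3 * q * C₀ * (lam2 * C₀ + lam2 * C₀ * Cmin) := by ring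
        _ = 3 * σ * q * C₀ * Cmin := by rw [← hσ_mul]; ring
    · calc ‖θ - t'‖ ≤ 3 * q * (lam2 * C₀ * lampsi) := hθ_err
        _ = 3 * (lam2 * C₀) * q * lampsi := by ring
        _ ≤ 3 * σ * q * lampsi := by gcongr
  have hq_le : 3 * σ ≤ 1 := by linarith
  intro n
  induction n with
  | zero =>
    -- The initial Stokes solve is a step of the iteration started from `(0, 0)`.
    obtain ⟨h₁, h₂⟩ := step 1 0 (un 0) 0 (θn 0) zero_le_one le_rfl (by simpa using hu_norm)
      (by simpa using hθ_norm) (by simpa using h0a) (by simpa using h0e)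
    rw [mul_one] at h₁ h₂
    rw [pow_zero]
    exact ⟨h₁.trans (by gcongr), h₂.trans (by gcongr)⟩
  | succ n ih =>
    rw [pow_succ']
    exact step _ _ _ _ _ (by positivity) (pow_le_one₀ (by positivity) hq_le) ih.1 ih.2
      (hstep_a n) (hstep_e n)
end

section
/- (Pressure convergence of the Stokes iteration.) In the abstract framework with the inf-sup form B, fix n ≥ 1 and suppose: (u, θ, ξ) ∈ V × Z × W satisfies a(u,v) + c(u,u,v) + B(ξ,v) + Q(θ,v) = L(v) for all v ∈ V; (uⁿ, θⁿ, ξⁿ) satisfies a(uⁿ,v) + c(uⁿ⁻¹,uⁿ⁻¹,v) + B(ξⁿ,v) + Q(θⁿ,v) = L(v) for all v ∈ V, where uⁿ⁻¹ ∈ V is the previous iterate; and the bounds ‖u‖ ≤ C₀, ‖uⁿ⁻¹‖ ≤ 2C₀, ‖u − uⁿ‖ ≤ (3σ)ⁿC₀, ‖u − uⁿ⁻¹‖ ≤ (3σ)ⁿ⁻¹C₀ and ‖θ − θⁿ‖ ≤ (3σ)ⁿλ_ψ hold. Then β*·‖ξ − ξⁿ‖ ≤ (C_max + 2·C_min)·(3σ)ⁿ·C₀.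 -/
theorem stmt_11
    {V Z : Type*} [NormedAddCommGroup V] [InnerProductSpace ℝ V] [CompleteSpace V]
    [NormedAddCommGroup Z] [InnerProductSpace ℝ Z] [CompleteSpace Z]
    (Cmin Cmax lam2 lamq Lam lampsi : ℝ)
    (hCmin : 0 < Cmin) (hCmax : 0 ≤ Cmax) (hlam2 : 0 ≤ lam2)
    (hlamq : 0 ≤ lamq) (hLam : 0 ≤ Lam) (hlampsi : 0 ≤ lampsi)
    (a : V →ₗ[ℝ] V →ₗ[ℝ] ℝ) (e : Z →ₗ[ℝ] Z →ₗ[ℝ] ℝ)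
    (c : V →ₗ[ℝ] V →ₗ[ℝ] V →ₗ[ℝ] ℝ) (h : V →ₗ[ℝ] Z →ₗ[ℝ] Z →ₗ[ℝ] ℝ)
    (Q : Z →ₗ[ℝ] V →ₗ[ℝ] ℝ) (L : V →ₗ[ℝ] ℝ) (Ψ : Z →ₗ[ℝ] ℝ)
    (ha_bdd : ∀ u v : V, |a u v| ≤ Cmax * ‖u‖ * ‖v‖)
    (ha_coer : ∀ v : V, Cmin * ‖v‖ ^ 2 ≤ a v v)
    (he_bdd : ∀ θ r : Z, |e θ r| ≤ ‖θ‖ * ‖r‖)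
    (he_coer : ∀ r : Z, ‖r‖ ^ 2 ≤ e r r)
    (hc_bdd : ∀ w u v : V, |c w u v| ≤ lam2 * ‖w‖ * ‖u‖ * ‖v‖)
    (hc_skew : ∀ w v : V, c w v v = 0)
    (hh_bdd : ∀ (w : V) (θ r : Z), |h w θ r| ≤ lam2 * ‖w‖ * ‖θ‖ * ‖r‖)
    (hh_skew : ∀ (w : V) (r : Z), h w r r = 0)
    (hQ_bdd : ∀ (θ : Z) (v : V), |Q θ v| ≤ lamq * ‖θ‖ * ‖v‖)
    (hL_bdd : ∀ v : V, |L v| ≤ Lam * ‖v‖)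
    (hPsi_bdd : ∀ r : Z, |Ψ r| ≤ lampsi * ‖r‖)
    {W : Type*} [NormedAddCommGroup W] [InnerProductSpace ℝ W] [CompleteSpace W]
    (B : W →ₗ[ℝ] V →ₗ[ℝ] ℝ) (betastar : ℝ) (hbetastar : 0 < betastar)
    (hinfsup : ∀ q : W, betastar * ‖q‖ ≤ ⨆ v : {v : V // v ≠ 0}, B q (v : V) / ‖(v : V)‖)
    (n : ℕ) (hn : 1 ≤ n)
    (u uN uPrev : V) (θ θN : Z) (ξ ξN : W)
    (hu : ∀ v : V, a u v + c u u v + B ξ v + Q θ v = L v)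
    (huN : ∀ v : V, a uN v + c uPrev uPrev v + B ξN v + Q θN v = L v)
    (hubdd : ‖u‖ ≤ ((Lam + lamq * lampsi) / Cmin))
    (hprevbdd : ‖uPrev‖ ≤ 2 * ((Lam + lamq * lampsi) / Cmin))
    (herrN : ‖u - uN‖ ≤ (3 * (lam2 * Lam / Cmin ^ 2 + lam2 * lamq * lampsi / Cmin ^ 2 + lam2 * lamq * lampsi / Cmin + lam2 * Lam / Cmin)) ^ n * ((Lam + lamq * lampsi) / Cmin))
    (herrPrev : ‖u - uPrev‖ ≤ (3 * (lam2 * Lam / Cmin ^ 2 + lam2 * lamq * lampsi / Cmin ^ 2 + lam2 * lamq * lampsi / Cmin + lam2 * Lam / Cmin)) ^ (n - 1) * ((Lam + lamq * lampsi) / Cmin))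
    (herrθ : ‖θ - θN‖ ≤ (3 * (lam2 * Lam / Cmin ^ 2 + lam2 * lamq * lampsi / Cmin ^ 2 + lam2 * lamq * lampsi / Cmin + lam2 * Lam / Cmin)) ^ n * lampsi) :
    betastar * ‖ξ - ξN‖ ≤ (Cmax + 2 * Cmin) * (3 * (lam2 * Lam / Cmin ^ 2 + lam2 * lamq * lampsi / Cmin ^ 2 + lam2 * lamq * lampsi / Cmin + lam2 * Lam / Cmin)) ^ n * ((Lam + lamq * lampsi) / Cmin) := by
  set C₀ : ℝ := (Lam + lamq * lampsi) / Cmin with hC₀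
  set σ : ℝ := lam2 * Lam / Cmin ^ 2 + lam2 * lamq * lampsi / Cmin ^ 2
    + lam2 * lamq * lampsi / Cmin + lam2 * Lam / Cmin with hσ
  have hC₀_nonneg : 0 ≤ C₀ := by positivity
  have hσ_nonneg : 0 ≤ σ := by positivity
  have hC₀_mul : Cmin * C₀ = Lam + lamq * lampsi := by
    rw [hC₀]; field_simp
  have hσ_mul : Cmin * σ = lam2 * C₀ * (1 + Cmin) := by
    rw [hσ, hC₀]; field_simp; ring
  have hconv : lam2 * C₀ ≤ Cmin * σ := by
    have : 0 ≤ lam2 * C₀ * Cmin := by positivity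
    linarith
  have hbuoy : lamq * lampsi ≤ Cmin * C₀ := by linarith
  have hpow : (3 * σ) ^ n = (3 * σ) ^ (n - 1) * (3 * σ) := by
    rw [← pow_succ, Nat.sub_add_cancel hn]
  refine (hinfsup (ξ - ξN)).trans (Real.iSup_le ?_ (by positivity))
  rintro ⟨v, hv⟩
  rw [div_le_iff₀ (norm_pos_iff.mpr hv)]
  have hB : B (ξ - ξN) v =
      -a (u - uN) v - c (u - uPrev) u v - c uPrev (u - uPrev) v - Q (θ - θN) v := by
    simp only [map_sub, LinearMap.sub_apply]
    linarith [hu v, huN v]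
  have h_a : |a (u - uN) v| ≤ Cmax * ((3 * σ) ^ n * C₀) * ‖v‖ :=
    (ha_bdd _ _).trans (by gcongr)
  have h_c₁ : |c (u - uPrev) u v| ≤ lam2 * ((3 * σ) ^ (n - 1) * C₀) * C₀ * ‖v‖ :=
    (hc_bdd _ _ _).trans (by gcongr)
  have h_c₂ : |c uPrev (u - uPrev) v| ≤ lam2 * (2 * C₀) * ((3 * σ) ^ (n - 1) * C₀) * ‖v‖ :=
    (hc_bdd _ _ _).trans (by gcongr)
  have h_Q : |Q (θ - θN) v| ≤ lamq * ((3 * σ) ^ n * lampsi) * ‖v‖ :=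
    (hQ_bdd _ _).trans (by gcongr)
  have h_c : lam2 * C₀ * (3 * (3 * σ) ^ (n - 1) * C₀ * ‖v‖) ≤ Cmin * (3 * σ) ^ n * C₀ * ‖v‖ := by
    calc lam2 * C₀ * (3 * (3 * σ) ^ (n - 1) * C₀ * ‖v‖)
        ≤ Cmin * σ * (3 * (3 * σ) ^ (n - 1) * C₀ * ‖v‖) := by gcongr
      _ = Cmin * (3 * σ) ^ n * C₀ * ‖v‖ := by rw [hpow]; ring
  have h_q : lamq * lampsi * ((3 * σ) ^ n * ‖v‖) ≤ Cmin * C₀ * ((3 * σ) ^ n * ‖v‖) := by gcongr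
  rw [hB]
  linarith [neg_le_of_abs_le h_a, neg_le_of_abs_le h_c₁, neg_le_of_abs_le h_c₂,
    neg_le_of_abs_le h_Q]
end

section
/- (Stability of the Newton iteration.) In the abstract framework, let (uⁿ)ₙ≥₀ ⊆ V and (θⁿ)ₙ≥₀ ⊆ Z satisfy: e(θ⁰,r) = Ψ(r) for all r ∈ Z, a(u⁰,v) + Q(θ⁰,v) = L(v) for all v ∈ V, and for every n ≥ 1: a(uⁿ,v) + c(uⁿ⁻¹,uⁿ,v) + c(uⁿ,uⁿ⁻¹,v) − c(uⁿ⁻¹,uⁿ⁻¹,v) + Q(θⁿ,v) = L(v) for all v ∈ V and e(θⁿ,r) + h(uⁿ⁻¹,θⁿ,r) + h(uⁿ,θⁿ⁻¹,r) − h(uⁿ⁻¹,θⁿ⁻¹,r) = Ψ(r) for all r ∈ Z. If 0 < σ < 1/3, then for every n ≥ 0 one has ‖uⁿ‖ ≤ (4/3)·C₀ and ‖θⁿ‖ ≤ (4/3)·λ_ψ. -/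
theorem mul_le_of_mul_sq_le_mul_s12 {k m x : ℝ} (hm : 0 ≤ m) (hx : 0 ≤ x)
    (h : k * x ^ 2 ≤ m * x) : k * x ≤ m := by
  rcases hx.eq_or_lt with rfl | hx
  · simpa using hm
  · exact le_of_mul_le_mul_right (by linarith [sq x, mul_assoc k x x]) hx

section Newton

variable {V Z : Type*} [NormedAddCommGroup V] [InnerProductSpace ℝ V]
  [NormedAddCommGroup Z] [InnerProductSpace ℝ Z]

/-- Energy estimate for a coercive problem with a skew-symmetric convection term, one right-hand
side functional and one further trilinear term. -/
theorem norm_le_of_convection_eq {k l m : ℝ} (hl : 0 ≤ l) (hm : 0 ≤ m)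
    {a : Z →ₗ[ℝ] Z →ₗ[ℝ] ℝ} {c : V →ₗ[ℝ] Z →ₗ[ℝ] Z →ₗ[ℝ] ℝ} {F : Z → ℝ}
    (ha : ∀ z, k * ‖z‖ ^ 2 ≤ a z z)
    (hc : ∀ w y z, |c w y z| ≤ l * ‖w‖ * ‖y‖ * ‖z‖) (hc0 : ∀ w z, c w z z = 0)
    (hF : ∀ z, |F z| ≤ m * ‖z‖) {w d : V} {y z : Z}
    (h : ∀ v, a z v + c w z v + c d y v = F v) :
    k * ‖z‖ ≤ l * ‖d‖ * ‖y‖ + m := by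
  refine mul_le_of_mul_sq_le_mul_s12 (by positivity) (norm_nonneg z) ?_
  have := h z
  rw [hc0] at this
  linarith [ha z, (abs_le.1 (hc d y z)).1, (abs_le.1 (hF z)).2]

/-- The increment `x - x'` of a Newton step solves a linearised problem whose right-hand side is
the residual `c d y` of the previous iterate. -/
theorem newton_increment_eq {a : Z →ₗ[ℝ] Z →ₗ[ℝ] ℝ} {c : V →ₗ[ℝ] Z →ₗ[ℝ] Z →ₗ[ℝ] ℝ}
    {F F' : Z → ℝ} {u u' d : V} {x x' y : Z}
    (hres : ∀ v, a x' v + c u' x' v - F' v = c d y v)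
    (hstep : ∀ v, a x v + c u' x v + c u x' v - c u' x' v = F v) (v : Z) :
    a (x - x') v + c u' (x - x') v + c (u - u') x' v = F v - F' v - c d y v := by
  simp only [map_sub, LinearMap.sub_apply]
  linarith [hres v, hstep v]

/-- The residual of a Newton iterate is quadratic in the increment. -/
theorem newton_residual_eq {a : Z →ₗ[ℝ] Z →ₗ[ℝ] ℝ} {c : V →ₗ[ℝ] Z →ₗ[ℝ] Z →ₗ[ℝ] ℝ}
    {F : Z → ℝ} {u u' : V} {x x' : Z}
    (hstep : ∀ v, a x v + c u' x v + c u x' v - c u' x' v = F v) (v : Z) :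
    a x v + c u x v - F v = c (u - u') (x - x') v := by
  simp only [map_sub, LinearMap.sub_apply]
  linarith [hstep v]

end Newton

theorem increment_bounds_of_coupled_estimates {C l q p K A B D E X Y κ ρ : ℝ}
    (hC : 0 < C) (hl : 0 ≤ l) (hq : 0 ≤ q) (hp : 0 ≤ p) (hK : 0 ≤ K) (hD : 0 ≤ D)
    (hX0 : 0 ≤ X) (hY0 : 0 ≤ Y) (hρ0 : 0 ≤ ρ)
    (hqp : q * p ≤ C * K) (hσ : l * (K + C * K) ≤ C / 3) (hσ' : l * K ≤ 1 / 3)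
    (hA : A ≤ κ * K) (hB : B ≤ κ * p) (hX : X ≤ ρ * K) (hY : Y ≤ ρ * p)
    (hvel : C * D ≤ l * D * A + (l * X * X + q * E))
    (htemp : E ≤ l * D * B + l * X * Y)
    (hκ : 0 ≤ κ) (hκ3 : κ < 3) (hκρ : κ / 2 + ρ ^ 2 ≤ 3 / 2) :
    D ≤ K / 2 ∧ E ≤ p / 2 := by
  have hXX : l * X * X ≤ l * (ρ * K) * (ρ * K) := by gcongr
  have hXY : l * X * Y ≤ l * (ρ * K) * (ρ * p) := by gcongr
  have hDA : l * D * A ≤ l * D * (κ * K) := by gcongr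
  have hDB : l * D * B ≤ l * D * (κ * p) := by gcongr
  have hE : q * E ≤ q * (l * D * (κ * p) + l * (ρ * K) * (ρ * p)) := by
    gcongr; linarith
  set s := κ * D + ρ ^ 2 * K with hs
  have hs0 : 0 ≤ s := by positivity
  have hCD : C * D ≤ C * (s / 3) := by
    calc C * D ≤ l * (K + q * p) * s := by rw [hs]; linarith
      _ ≤ l * (K + C * K) * s := by gcongr
      _ ≤ C / 3 * s := by gcongr
      _ = C * (s / 3) := by ring
  have hDs : D ≤ s / 3 := le_of_mul_le_mul_left hCD hC
  have hDK : D ≤ K / 2 := by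
    by_contra! hlt
    have h1 : ρ ^ 2 * K ≤ (3 / 2 - κ / 2) * K := by gcongr; linarith
    have h2 : 0 < (3 - κ) * (D - K / 2) := mul_pos (by linarith) (by linarith)
    linarith
  refine ⟨hDK, ?_⟩
  calc E ≤ l * D * (κ * p) + l * (ρ * K) * (ρ * p) := by linarith
    _ ≤ l * (K / 2) * (κ * p) + l * (ρ * K) * (ρ * p) := by gcongr
    _ = l * K * (κ / 2 + ρ ^ 2) * p := by ring
    _ ≤ 1 / 3 * (3 / 2) * p := by gcongr
    _ = p / 2 := by ring

theorem stmt_12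
    {V Z : Type*} [NormedAddCommGroup V] [InnerProductSpace ℝ V] [CompleteSpace V]
    [NormedAddCommGroup Z] [InnerProductSpace ℝ Z] [CompleteSpace Z]
    (Cmin Cmax lam2 lamq Lam lampsi : ℝ)
    (hCmin : 0 < Cmin) (hCmax : 0 ≤ Cmax) (hlam2 : 0 ≤ lam2)
    (hlamq : 0 ≤ lamq) (hLam : 0 ≤ Lam) (hlampsi : 0 ≤ lampsi)
    (a : V →ₗ[ℝ] V →ₗ[ℝ] ℝ) (e : Z →ₗ[ℝ] Z →ₗ[ℝ] ℝ)
    (c : V →ₗ[ℝ] V →ₗ[ℝ] V →ₗ[ℝ] ℝ) (h : V →ₗ[ℝ] Z →ₗ[ℝ] Z →ₗ[ℝ] ℝ)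
    (Q : Z →ₗ[ℝ] V →ₗ[ℝ] ℝ) (L : V →ₗ[ℝ] ℝ) (Ψ : Z →ₗ[ℝ] ℝ)
    (ha_bdd : ∀ u v : V, |a u v| ≤ Cmax * ‖u‖ * ‖v‖)
    (ha_coer : ∀ v : V, Cmin * ‖v‖ ^ 2 ≤ a v v)
    (he_bdd : ∀ θ r : Z, |e θ r| ≤ ‖θ‖ * ‖r‖)
    (he_coer : ∀ r : Z, ‖r‖ ^ 2 ≤ e r r)
    (hc_bdd : ∀ w u v : V, |c w u v| ≤ lam2 * ‖w‖ * ‖u‖ * ‖v‖)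
    (hc_skew : ∀ w v : V, c w v v = 0)
    (hh_bdd : ∀ (w : V) (θ r : Z), |h w θ r| ≤ lam2 * ‖w‖ * ‖θ‖ * ‖r‖)
    (hh_skew : ∀ (w : V) (r : Z), h w r r = 0)
    (hQ_bdd : ∀ (θ : Z) (v : V), |Q θ v| ≤ lamq * ‖θ‖ * ‖v‖)
    (hL_bdd : ∀ v : V, |L v| ≤ Lam * ‖v‖)
    (hPsi_bdd : ∀ r : Z, |Ψ r| ≤ lampsi * ‖r‖)
    (un : ℕ → V) (θn : ℕ → Z)
    (h0e : ∀ r : Z, e (θn 0) r = Ψ r)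
    (h0a : ∀ v : V, a (un 0) v + Q (θn 0) v = L v)
    (hstep_a : ∀ (n : ℕ) (v : V),
      a (un (n + 1)) v + c (un n) (un (n + 1)) v + c (un (n + 1)) (un n) v
        - c (un n) (un n) v + Q (θn (n + 1)) v = L v)
    (hstep_e : ∀ (n : ℕ) (r : Z),
      e (θn (n + 1)) r + h (un n) (θn (n + 1)) r + h (un (n + 1)) (θn n) r
        - h (un n) (θn n) r = Ψ r)
    (hsig_pos : 0 < (lam2 * Lam / Cmin ^ 2 + lam2 * lamq * lampsi / Cmin ^ 2 + lam2 * lamq * lampsi / Cmin + lam2 * Lam / Cmin)) (hsig_lt : (lam2 * Lam / Cmin ^ 2 + lam2 * lamq * lampsi / Cmin ^ 2 + lam2 * lamq * lampsi / Cmin + lam2 * Lam / Cmin) < 1 / 3) :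
    ∀ n : ℕ, ‖un n‖ ≤ (4 / 3) * ((Lam + lamq * lampsi) / Cmin) ∧ ‖θn n‖ ≤ (4 / 3) * lampsi := by
  set K := (Lam + lamq * lampsi) / Cmin with hKdef
  have hK : 0 ≤ K := by positivity
  have hCK : Cmin * K = Lam + lamq * lampsi := mul_div_cancel₀ _ hCmin.ne'
  have hσ_eq : lam2 * Lam / Cmin ^ 2 + lam2 * lamq * lampsi / Cmin ^ 2
      + lam2 * lamq * lampsi / Cmin + lam2 * Lam / Cmin = lam2 * K / Cmin + lam2 * K := by
    rw [hKdef]; field_simp; ring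
  rw [hσ_eq] at hsig_lt
  have hσ' : lam2 * K ≤ 1 / 3 := by
    have : 0 ≤ lam2 * K / Cmin := by positivity
    linarith
  have hσ : lam2 * (K + Cmin * K) ≤ Cmin / 3 := by
    calc lam2 * (K + Cmin * K) = Cmin * (lam2 * K / Cmin + lam2 * K) := by field_simp
      _ ≤ Cmin * (1 / 3) := by gcongr
      _ = Cmin / 3 := by ring
  have hqp : lamq * lampsi ≤ Cmin * K := by linarith
  have he_coer' : ∀ r : Z, 1 * ‖r‖ ^ 2 ≤ e r r := by simpa using he_coer
  have hLQ : ∀ (θ : Z) (v : V), |L v - Q θ v| ≤ (Lam + lamq * ‖θ‖) * ‖v‖ := fun θ v => by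
    linarith [abs_sub (L v) (Q θ v), hL_bdd v, hQ_bdd θ v]
  have hstep_a' : ∀ (n : ℕ) (v : V), a (un (n + 1)) v + c (un n) (un (n + 1)) v
      + c (un (n + 1)) (un n) v - c (un n) (un n) v = L v - Q (θn (n + 1)) v := fun n v => by
    linarith [hstep_a n v]
  have increment : ∀ (n : ℕ) (d : V) (y : Z) (κ ρ : ℝ), 0 ≤ κ → κ < 3 → 0 ≤ ρ →
      κ / 2 + ρ ^ 2 ≤ 3 / 2 →
      (∀ v, a (un n) v + c (un n) (un n) v - (L v - Q (θn n) v) = c d d v) →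
      (∀ r, e (θn n) r + h (un n) (θn n) r - Ψ r = h d y r) →
      ‖un n‖ ≤ κ * K → ‖θn n‖ ≤ κ * lampsi → ‖d‖ ≤ ρ * K → ‖y‖ ≤ ρ * lampsi →
      ‖un (n + 1) - un n‖ ≤ K / 2 ∧ ‖θn (n + 1) - θn n‖ ≤ lampsi / 2 := by
    intro n d y κ ρ hκ hκ3 hρ hκρ hresa hrese hu hθ hd hy
    have hvel := norm_le_of_convection_eq hlam2
      (m := lam2 * ‖d‖ * ‖d‖ + lamq * ‖θn (n + 1) - θn n‖) (by positivity)
      ha_coer hc_bdd hc_skew (fun v => by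
        have hQ := abs_le.1 (hQ_bdd (θn (n + 1) - θn n) v)
        have hc := abs_le.1 (hc_bdd d d v)
        simp only [map_sub, LinearMap.sub_apply] at hQ
        rw [abs_le]
        constructor <;> linarith)
      (newton_increment_eq hresa (hstep_a' n))
    have htemp := norm_le_of_convection_eq hlam2
      (m := lam2 * ‖d‖ * ‖y‖) (by positivity) he_coer' hh_bdd hh_skew (fun r => by
        have hh := hh_bdd d y r
        rwa [sub_self, zero_sub, abs_neg])
      (newton_increment_eq hrese (hstep_e n))
    rw [one_mul] at htemp
    exact increment_bounds_of_coupled_estimates hCmin hlam2 hlamq hlampsi hK (norm_nonneg _)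
      (norm_nonneg _) (norm_nonneg _) hρ hqp hσ hσ' hu hθ hd hy hvel htemp hκ hκ3 hκρ
  have hθ0 : ‖θn 0‖ ≤ lampsi := by
    have := norm_le_of_convection_eq (w := (0 : V)) (d := 0) (y := 0) hlam2 hlampsi he_coer'
      hh_bdd hh_skew hPsi_bdd (z := θn 0) (by simpa using h0e)
    simpa using this
  have hu0 : ‖un 0‖ ≤ K := by
    have := norm_le_of_convection_eq (w := (0 : V)) (d := 0) (y := 0) hlam2
      (by positivity) ha_coer hc_bdd hc_skew (hLQ (θn 0)) (z := un 0)
      (fun v => by simpa using eq_sub_of_add_eq (h0a v))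
    rw [norm_zero, mul_zero, zero_add] at this
    refine le_of_mul_le_mul_left ?_ hCmin
    rw [hCK]
    exact this.trans (by gcongr)
  have bounds : ∀ n, ‖un n‖ ≤ 4 / 3 * K → ‖θn n‖ ≤ 4 / 3 * lampsi →
      ‖un (n + 1) - un n‖ ≤ K / 2 →
      ‖un (n + 1)‖ ≤ 4 / 3 * K ∧ ‖θn (n + 1)‖ ≤ 4 / 3 * lampsi := by
    intro n hu hθ hd
    have htemp := norm_le_of_convection_eq (d := un (n + 1) - un n) (y := θn n) (w := un n)
      (z := θn (n + 1)) hlam2 hlampsi he_coer' hh_bdd hh_skew hPsi_bdd (fun r => by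
        simp only [map_sub, LinearMap.sub_apply]
        linarith [hstep_e n r])
    have hvel := norm_le_of_convection_eq (d := un (n + 1) - un n) (y := un n) (w := un n)
      (z := un (n + 1)) hlam2 (by positivity) ha_coer hc_bdd hc_skew (hLQ (θn (n + 1)))
      (fun v => by
        simp only [map_sub, LinearMap.sub_apply]
        linarith [hstep_a' n v])
    have hdu : lam2 * ‖un (n + 1) - un n‖ * ‖un n‖ ≤ lam2 * (K / 2) * (4 / 3 * K) := by gcongr
    have hdθ : lam2 * ‖un (n + 1) - un n‖ * ‖θn n‖ ≤ lam2 * (K / 2) * (4 / 3 * lampsi) := by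
      gcongr
    have hθ' : ‖θn (n + 1)‖ ≤ lampsi + 2 / 3 * (lam2 * K * lampsi) := by linarith
    refine ⟨le_of_mul_le_mul_left ?_ hCmin, ?_⟩
    · have hqθ : lamq * ‖θn (n + 1)‖ ≤ lamq * (lampsi + 2 / 3 * (lam2 * K * lampsi)) := by gcongr
      have h1 : lam2 * K * (lamq * lampsi) ≤ lam2 * K * (Cmin * K) := by gcongr
      have h2 : lam2 * (K + Cmin * K) * K ≤ Cmin / 3 * K := by gcongr
      have h3 : 0 ≤ Cmin * K := by positivity
      linarith
    · have : lam2 * K * lampsi ≤ 1 / 3 * lampsi := by gcongr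
      linarith
  have invariant : ∀ n, ‖un n‖ ≤ 4 / 3 * K ∧ ‖θn n‖ ≤ 4 / 3 * lampsi ∧
      ‖un (n + 1) - un n‖ ≤ K / 2 ∧ ‖θn (n + 1) - θn n‖ ≤ lampsi / 2 := by
    intro n
    induction n with
    | zero =>
      refine ⟨by linarith, by linarith, ?_⟩
      exact increment 0 (un 0) (θn 0) 1 1 zero_le_one (by norm_num) zero_le_one (by norm_num)
        (fun v => by linarith [h0a v]) (fun r => by linarith [h0e r])
        (by linarith) (by linarith) (by linarith) (by linarith)
    | succ n ih =>
      obtain ⟨hu, hθ, hd, hδ⟩ := ih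
      obtain ⟨hu', hθ'⟩ := bounds n hu hθ hd
      refine ⟨hu', hθ', ?_⟩
      exact increment (n + 1) _ _ (4 / 3) (1 / 2) (by norm_num) (by norm_num) (by norm_num)
        (by norm_num)
        (newton_residual_eq (hstep_a' n)) (newton_residual_eq (hstep_e n))
        hu' hθ' (by linarith) (by linarith)
  exact fun n => ⟨(invariant n).1, (invariant n).2.1⟩
end

section
/- (Quadratic convergence of the Newton iteration.) In the abstract framework, let (u, θ) ∈ V × Z solve the coupled problem, and let (uⁿ)ₙ≥₀ ⊆ V and (θⁿ)ₙ≥₀ ⊆ Z satisfy: e(θ⁰,r) = Ψ(r) for all r ∈ Z, a(u⁰,v) + Q(θ⁰,v) = L(v) for all v ∈ V, and for every n ≥ 1: a(uⁿ,v) + c(uⁿ⁻¹,uⁿ,v) + c(uⁿ,uⁿ⁻¹,v) − c(uⁿ⁻¹,uⁿ⁻¹,v) + Q(θⁿ,v) = L(v) for all v ∈ V and e(θⁿ,r) + h(uⁿ⁻¹,θⁿ,r) + h(uⁿ,θⁿ⁻¹,r) − h(uⁿ⁻¹,θⁿ⁻¹,r) = Ψ(r) for all r ∈ Z. If 0 <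 σ < 1/3, then for every n ≥ 0 one has ‖u − uⁿ‖ ≤ ((9/5)σ)^(2ⁿ − 1)·C₀ and ‖θ − θⁿ‖ ≤ ((9/5)σ)^(2ⁿ − 1)·λ_ψ. -/
/-- Cancel one factor of a norm in an energy estimate. -/
lemma mul_le_of_mul_sq_le {C M t : ℝ} (hM : 0 ≤ M) (ht : 0 ≤ t) (h : C * t ^ 2 ≤ M * t) :
    C * t ≤ M := by
  rcases ht.eq_or_lt with rfl | ht
  · simpa using hM
  · exact le_of_mul_le_mul_right (by nlinarith) ht

/-- The error contraction of one Newton step, given the two energy estimates for the new errors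
`A` and `B` and a relative bound `m` for the old errors. -/
lemma newton_error_step {C K x y l q p s m A B : ℝ} (hC : 0 < C) (hK : 0 ≤ K) (hl : 0 ≤ l)
    (hq : 0 ≤ q) (hp : 0 ≤ p) (hm : 0 ≤ m) (hms : m ≤ s) (hs : s < 1 / 3) (hA : 0 ≤ A)
    (hqp : q * p ≤ C * K) (hy : l * K = y) (hx : C * x = y) (hxy : x + y = s)
    (hB : B ≤ l * A * (p * (1 + m)) + l * (m * K) * (m * p))
    (hCA : C * A ≤ l * (K * (1 + m)) * A + l * (m * K) * (m * K) + q * B) :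
    A ≤ 9 / 5 * s * m ^ 2 * K ∧ B ≤ 9 / 5 * s * m ^ 2 * p := by
  have hy0 : 0 ≤ y := hy ▸ mul_nonneg hl hK
  have hx0 : 0 ≤ x := nonneg_of_mul_nonneg_right (hx ▸ hy0) hC
  have hqB : q * B ≤ C * (y * ((1 + m) * A + m ^ 2 * K)) := by
    calc q * B ≤ q * (l * A * (p * (1 + m)) + l * (m * K) * (m * p)) := by gcongr
      _ = (q * p) * (l * ((1 + m) * A + m ^ 2 * K)) := by ring
      _ ≤ (C * K) * (l * ((1 + m) * A + m ^ 2 * K)) := by gcongr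
      _ = C * (y * ((1 + m) * A + m ^ 2 * K)) := by rw [← hy]; ring
  have hAs : A ≤ s * ((1 + m) * A + m ^ 2 * K) := by
    refine le_of_mul_le_mul_left ?_ hC
    calc C * A ≤ l * (K * (1 + m)) * A + l * (m * K) * (m * K) + q * B := hCA
      _ = (l * K) * ((1 + m) * A + m ^ 2 * K) + q * B := by ring
      _ ≤ (C * x) * ((1 + m) * A + m ^ 2 * K)
          + C * (y * ((1 + m) * A + m ^ 2 * K)) := by rw [hy, hx]; gcongr
      _ = C * (s * ((1 + m) * A + m ^ 2 * K)) := by rw [← hxy]; ring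
  have hsm : s * (1 + m) ≤ 4 / 9 := by nlinarith
  have hA' : A ≤ 9 / 5 * s * m ^ 2 * K := by
    have := mul_le_mul_of_nonneg_right hsm hA
    linarith
  refine ⟨hA', ?_⟩
  have hA'' : (1 + m) * A ≤ 4 / 5 * (m ^ 2 * K) := by
    calc (1 + m) * A ≤ (1 + m) * (9 / 5 * s * m ^ 2 * K) := by gcongr
      _ = 9 / 5 * (s * (1 + m)) * (m ^ 2 * K) := by ring
      _ ≤ 9 / 5 * (4 / 9) * (m ^ 2 * K) := by gcongr
      _ = 4 / 5 * (m ^ 2 * K) := by ring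
  calc B ≤ l * A * (p * (1 + m)) + l * (m * K) * (m * p) := hB
    _ = p * l * ((1 + m) * A + m ^ 2 * K) := by ring
    _ ≤ p * l * (4 / 5 * (m ^ 2 * K) + m ^ 2 * K) := by gcongr
    _ = 9 / 5 * y * m ^ 2 * p := by rw [← hy]; ring
    _ ≤ 9 / 5 * s * m ^ 2 * p := by gcongr; linarith

theorem stmt_13
    {V Z : Type*} [NormedAddCommGroup V] [InnerProductSpace ℝ V] [CompleteSpace V]
    [NormedAddCommGroup Z] [InnerProductSpace ℝ Z] [CompleteSpace Z]
    (Cmin Cmax lam2 lamq Lam lampsi : ℝ)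
    (hCmin : 0 < Cmin) (hCmax : 0 ≤ Cmax) (hlam2 : 0 ≤ lam2)
    (hlamq : 0 ≤ lamq) (hLam : 0 ≤ Lam) (hlampsi : 0 ≤ lampsi)
    (a : V →ₗ[ℝ] V →ₗ[ℝ] ℝ) (e : Z →ₗ[ℝ] Z →ₗ[ℝ] ℝ)
    (c : V →ₗ[ℝ] V →ₗ[ℝ] V →ₗ[ℝ] ℝ) (h : V →ₗ[ℝ] Z →ₗ[ℝ] Z →ₗ[ℝ] ℝ)
    (Q : Z →ₗ[ℝ] V →ₗ[ℝ] ℝ) (L : V →ₗ[ℝ] ℝ) (Ψ : Z →ₗ[ℝ] ℝ)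
    (ha_bdd : ∀ u v : V, |a u v| ≤ Cmax * ‖u‖ * ‖v‖)
    (ha_coer : ∀ v : V, Cmin * ‖v‖ ^ 2 ≤ a v v)
    (he_bdd : ∀ θ r : Z, |e θ r| ≤ ‖θ‖ * ‖r‖)
    (he_coer : ∀ r : Z, ‖r‖ ^ 2 ≤ e r r)
    (hc_bdd : ∀ w u v : V, |c w u v| ≤ lam2 * ‖w‖ * ‖u‖ * ‖v‖)
    (hc_skew : ∀ w v : V, c w v v = 0)
    (hh_bdd : ∀ (w : V) (θ r : Z), |h w θ r| ≤ lam2 * ‖w‖ * ‖θ‖ * ‖r‖)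
    (hh_skew : ∀ (w : V) (r : Z), h w r r = 0)
    (hQ_bdd : ∀ (θ : Z) (v : V), |Q θ v| ≤ lamq * ‖θ‖ * ‖v‖)
    (hL_bdd : ∀ v : V, |L v| ≤ Lam * ‖v‖)
    (hPsi_bdd : ∀ r : Z, |Ψ r| ≤ lampsi * ‖r‖)
    (u : V) (θ : Z)
    (hu : ∀ v : V, a u v + c u u v + Q θ v = L v)
    (hθ : ∀ r : Z, e θ r + h u θ r = Ψ r)
    (un : ℕ → V) (θn : ℕ → Z)
    (h0e : ∀ r : Z, e (θn 0) r = Ψ r)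
    (h0a : ∀ v : V, a (un 0) v + Q (θn 0) v = L v)
    (hstep_a : ∀ (n : ℕ) (v : V),
      a (un (n + 1)) v + c (un n) (un (n + 1)) v + c (un (n + 1)) (un n) v
        - c (un n) (un n) v + Q (θn (n + 1)) v = L v)
    (hstep_e : ∀ (n : ℕ) (r : Z),
      e (θn (n + 1)) r + h (un n) (θn (n + 1)) r + h (un (n + 1)) (θn n) r
        - h (un n) (θn n) r = Ψ r)
    (hsig_pos : 0 < (lam2 * Lam / Cmin ^ 2 + lam2 * lamq * lampsi / Cmin ^ 2 + lam2 * lamq * lampsi / Cmin + lam2 * Lam / Cmin)) (hsig_lt : (lam2 * Lam / Cmin ^ 2 + lam2 * lamq * lampsi / Cmin ^ 2 + lam2 * lamq * lampsi / Cmin + lam2 * Lam / Cmin) < 1 / 3) :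
    ∀ n : ℕ, ‖u - un n‖ ≤ ((9 / 5) * (lam2 * Lam / Cmin ^ 2 + lam2 * lamq * lampsi / Cmin ^ 2 + lam2 * lamq * lampsi / Cmin + lam2 * Lam / Cmin)) ^ (2 ^ n - 1) * ((Lam + lamq * lampsi) / Cmin) ∧
      ‖θ - θn n‖ ≤ ((9 / 5) * (lam2 * Lam / Cmin ^ 2 + lam2 * lamq * lampsi / Cmin ^ 2 + lam2 * lamq * lampsi / Cmin + lam2 * Lam / Cmin)) ^ (2 ^ n - 1) * lampsi := by
  set s : ℝ := lam2 * Lam / Cmin ^ 2 + lam2 * lamq * lampsi / Cmin ^ 2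
    + lam2 * lamq * lampsi / Cmin + lam2 * Lam / Cmin with hs
  set K : ℝ := (Lam + lamq * lampsi) / Cmin with hK
  have hK0 : 0 ≤ K := by positivity
  have hCK : Cmin * K = Lam + lamq * lampsi := by rw [hK]; field_simp
  have hqp : lamq * lampsi ≤ Cmin * K := by linarith
  obtain ⟨y, hy⟩ : ∃ y, lam2 * K = y := ⟨_, rfl⟩
  obtain ⟨x, hx⟩ : ∃ x, Cmin * x = y := ⟨y / Cmin, by field_simp⟩
  have hxy : x + y = s := by
    have hx' : x = y / Cmin := by rw [← hx]; field_simp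
    rw [hx', ← hy, hK, hs]; field_simp; ring
  have hy0 : 0 ≤ y := hy ▸ mul_nonneg hlam2 hK0
  have hx0 : 0 ≤ x := nonneg_of_mul_nonneg_right (hx ▸ hy0) hCmin
  have hθ_le : ‖θ‖ ≤ lampsi := by
    have := mul_le_of_mul_sq_le (C := 1) hlampsi (norm_nonneg θ) (by
      have h1 := hθ θ
      rw [hh_skew] at h1
      linarith [he_coer θ, le_of_abs_le (hPsi_bdd θ)])
    linarith
  have hu_le : ‖u‖ ≤ K := by
    refine le_of_mul_le_mul_left (hCK ▸ ?_) hCmin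
    refine mul_le_of_mul_sq_le (by positivity) (norm_nonneg u) ?_
    have h1 := hu u
    rw [hc_skew] at h1
    have h2 : lamq * ‖θ‖ * ‖u‖ ≤ lamq * lampsi * ‖u‖ := by gcongr
    linarith [ha_coer u, le_of_abs_le (hL_bdd u), neg_le_of_abs_le (hQ_bdd θ u)]
  have key : ∀ n : ℕ, ∃ m : ℝ, 0 ≤ m ∧ m ≤ s ∧ m ≤ (9 / 5 * s) ^ (2 ^ n - 1) ∧
      ‖u - un n‖ ≤ m * K ∧ ‖θ - θn n‖ ≤ m * lampsi := by
    intro n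
    induction n with
    | zero =>
      have hT : ‖θ - θn 0‖ ≤ y * lampsi := by
        have := mul_le_of_mul_sq_le (C := 1) (M := y * lampsi) (by positivity)
          (norm_nonneg (θ - θn 0)) (by
            have h1 := hθ (θ - θn 0)
            have h2 := h0e (θ - θn 0)
            have h3 := he_coer (θ - θn 0)
            have h4 := neg_le_of_abs_le (hh_bdd u θ (θ - θn 0))
            have h5 : lam2 * ‖u‖ * ‖θ‖ * ‖θ - θn 0‖ ≤ y * lampsi * ‖θ - θn 0‖ := by
              rw [← hy]; gcongr
            rw [map_sub e, LinearMap.sub_apply] at h3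
            linarith)
        linarith
      have hE : ‖u - un 0‖ ≤ s * K := by
        refine le_of_mul_le_mul_left ?_ hCmin
        have h0 : Cmin * ‖u - un 0‖ ≤ y * K + lamq * (y * lampsi) := by
          refine mul_le_of_mul_sq_le (by positivity) (norm_nonneg _) ?_
          have h1 := hu (u - un 0)
          have h2 := h0a (u - un 0)
          have h3 := ha_coer (u - un 0)
          have h4 := neg_le_of_abs_le (hc_bdd u u (u - un 0))
          have h5 : lam2 * ‖u‖ * ‖u‖ * ‖u - un 0‖ ≤ y * K * ‖u - un 0‖ := by
            rw [← hy]; gcongr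
          have h6 := neg_le_of_abs_le (hQ_bdd (θ - θn 0) (u - un 0))
          have h7 : lamq * ‖θ - θn 0‖ * ‖u - un 0‖ ≤ lamq * (y * lampsi) * ‖u - un 0‖ := by
            gcongr
          rw [map_sub a, LinearMap.sub_apply] at h3
          rw [map_sub Q, LinearMap.sub_apply] at h6
          linarith
        have h8 := mul_le_mul_of_nonneg_right hqp hy0
        calc Cmin * ‖u - un 0‖ ≤ y * K + lamq * (y * lampsi) := h0
          _ ≤ (Cmin * x) * K + Cmin * K * y := by rw [hx]; linarith
          _ = Cmin * (s * K) := by rw [← hxy]; ring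
      refine ⟨s, hsig_pos.le, le_rfl, by norm_num; linarith, hE, hT.trans ?_⟩
      gcongr
      linarith
    | succ n ih =>
      obtain ⟨m, hm, hms, hmq, hE, hT⟩ := ih
      have hun : ‖un n‖ ≤ K * (1 + m) := by
        have := norm_sub_le u (u - un n)
        rw [sub_sub_cancel] at this
        linarith
      have hθn : ‖θn n‖ ≤ lampsi * (1 + m) := by
        have := norm_sub_le θ (θ - θn n)
        rw [sub_sub_cancel] at this
        linarith
      set E := u - un (n + 1) with hEdef
      set T := θ - θn (n + 1) with hTdef
      have hB : ‖T‖ ≤ lam2 * ‖E‖ * (lampsi * (1 + m)) + lam2 * (m * K) * (m * lampsi) := by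
        have := mul_le_of_mul_sq_le (C := 1)
          (M := lam2 * ‖E‖ * (lampsi * (1 + m)) + lam2 * (m * K) * (m * lampsi))
          (by positivity) (norm_nonneg T) (by
            have herr : e T T + h (un n) T T + h E (θn n) T
                + h (u - un n) (θ - θn n) T = 0 := by
              have h1 := hθ T
              have h2 := hstep_e n T
              have h3 : e T T = e θ T - e (θn (n + 1)) T := by
                conv_lhs => rw [hTdef, map_sub e, LinearMap.sub_apply, ← hTdef]
              have h4 : h (un n) T T = h (un n) θ T - h (un n) (θn (n + 1)) T := by
                conv_lhs => rw [hTdef, map_sub (h (un n)), LinearMap.sub_apply, ← hTdef]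
              rw [h3, h4, hEdef]
              simp only [map_sub h, map_sub (h _), LinearMap.sub_apply]
              linarith
            rw [hh_skew] at herr
            have h5 := neg_le_of_abs_le (hh_bdd E (θn n) T)
            have h6 := neg_le_of_abs_le (hh_bdd (u - un n) (θ - θn n) T)
            have h7 : lam2 * ‖E‖ * ‖θn n‖ * ‖T‖ ≤ lam2 * ‖E‖ * (lampsi * (1 + m)) * ‖T‖ := by
              gcongr
            have h8 : lam2 * ‖u - un n‖ * ‖θ - θn n‖ * ‖T‖
                ≤ lam2 * (m * K) * (m * lampsi) * ‖T‖ := by gcongr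
            linarith [he_coer T])
        linarith
      have hCA : Cmin * ‖E‖ ≤ lam2 * (K * (1 + m)) * ‖E‖ + lam2 * (m * K) * (m * K)
          + lamq * ‖T‖ := by
        refine mul_le_of_mul_sq_le (by positivity) (norm_nonneg E) ?_
        have herr : a E E + c (un n) E E + c E (un n) E
            + c (u - un n) (u - un n) E + Q T E = 0 := by
          have h1 := hu E
          have h2 := hstep_a n E
          have h3 : a E E = a u E - a (un (n + 1)) E := by
            conv_lhs => rw [hEdef, map_sub a, LinearMap.sub_apply, ← hEdef]
          have h4 : c (un n) E E = c (un n) u E - c (un n) (un (n + 1)) E := by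
            conv_lhs => rw [hEdef, map_sub (c (un n)), LinearMap.sub_apply, ← hEdef]
          have h5 : c E (un n) E = c u (un n) E - c (un (n + 1)) (un n) E := by
            conv_lhs => rw [hEdef, map_sub c, LinearMap.sub_apply, LinearMap.sub_apply, ← hEdef]
          rw [h3, h4, h5, hTdef]
          simp only [map_sub c, map_sub (c _), map_sub Q, LinearMap.sub_apply]
          linarith
        rw [hc_skew] at herr
        have h5 := neg_le_of_abs_le (hc_bdd E (un n) E)
        have h6 := neg_le_of_abs_le (hc_bdd (u - un n) (u - un n) E)
        have h7 : lam2 * ‖E‖ * ‖un n‖ * ‖E‖ ≤ lam2 * ‖E‖ * (K * (1 + m)) * ‖E‖ := by gcongr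
        have h8 : lam2 * ‖u - un n‖ * ‖u - un n‖ * ‖E‖
            ≤ lam2 * (m * K) * (m * K) * ‖E‖ := by gcongr
        linarith [ha_coer E, neg_le_of_abs_le (hQ_bdd T E)]
      obtain ⟨hA', hB'⟩ := newton_error_step hCmin hK0 hlam2 hlamq hlampsi hm hms hsig_lt
        (norm_nonneg E) hqp hy hx hxy hB hCA
      refine ⟨9 / 5 * s * m ^ 2, by positivity, ?_, ?_, hA', hB'⟩
      · have hm1 : m ^ 2 ≤ 1 / 9 := by nlinarith
        have := mul_le_mul_of_nonneg_left hm1 hsig_pos.le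
        linarith
      · have hexp : 2 ^ (n + 1) - 1 = (2 ^ n - 1) * 2 + 1 := by
          have := Nat.one_le_two_pow (n := n)
          rw [pow_succ]
          omega
        rw [hexp, pow_succ _ (_ * 2), pow_mul, mul_comm (9 / 5 * s)]
        gcongr
  intro n
  obtain ⟨m, -, -, hmq, hE, hT⟩ := key n
  exact ⟨hE.trans (by gcongr), hT.trans (by gcongr)⟩
end

section
/- (Pressure convergence of the Newton iteration.) In the abstract framework with the inf-sup form B, assume 0 < σ < 1/3, fix n ≥ 1 and suppose: (u, θ, ξ) ∈ V × Z × W satisfies a(u,v) + c(u,u,v) + B(ξ,v) + Q(θ,v) = L(v) for all v ∈ V; (uⁿ, θⁿ, ξⁿ) satisfies a(uⁿ,v) + c(uⁿ⁻¹,uⁿ,v) + c(uⁿ,uⁿ⁻¹,v) − c(uⁿ⁻¹,uⁿ⁻¹,v) + B(ξⁿ,v) + Q(θⁿ,v) = L(v) for all v ∈ V, where uⁿ⁻¹ ∈ V is the previous iterate; and the bounds ‖uⁿ⁻¹‖ ≤ (4/3)C₀, ‖u − uⁿ‖ ≤ ((9/5)σ)^(2ⁿ − 1)C₀, ‖u −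 uⁿ⁻¹‖ ≤ ((9/5)σ)^(2ⁿ⁻¹ − 1)C₀ and ‖θ − θⁿ‖ ≤ ((9/5)σ)^(2ⁿ − 1)λ_ψ hold. Then β*·‖ξ − ξⁿ‖ ≤ (C_max + (22/9)·C_min)·((9/5)σ)^(2ⁿ − 1)·C₀. -/
theorem stmt_14
    {V Z : Type*} [NormedAddCommGroup V] [InnerProductSpace ℝ V] [CompleteSpace V]
    [NormedAddCommGroup Z] [InnerProductSpace ℝ Z] [CompleteSpace Z]
    (Cmin Cmax lam2 lamq Lam lampsi : ℝ)
    (hCmin : 0 < Cmin) (hCmax : 0 ≤ Cmax) (hlam2 : 0 ≤ lam2)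
    (hlamq : 0 ≤ lamq) (hLam : 0 ≤ Lam) (hlampsi : 0 ≤ lampsi)
    (a : V →ₗ[ℝ] V →ₗ[ℝ] ℝ) (e : Z →ₗ[ℝ] Z →ₗ[ℝ] ℝ)
    (c : V →ₗ[ℝ] V →ₗ[ℝ] V →ₗ[ℝ] ℝ) (h : V →ₗ[ℝ] Z →ₗ[ℝ] Z →ₗ[ℝ] ℝ)
    (Q : Z →ₗ[ℝ] V →ₗ[ℝ] ℝ) (L : V →ₗ[ℝ] ℝ) (Ψ : Z →ₗ[ℝ] ℝ)
    (ha_bdd : ∀ u v : V, |a u v| ≤ Cmax * ‖u‖ * ‖v‖)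
    (ha_coer : ∀ v : V, Cmin * ‖v‖ ^ 2 ≤ a v v)
    (he_bdd : ∀ θ r : Z, |e θ r| ≤ ‖θ‖ * ‖r‖)
    (he_coer : ∀ r : Z, ‖r‖ ^ 2 ≤ e r r)
    (hc_bdd : ∀ w u v : V, |c w u v| ≤ lam2 * ‖w‖ * ‖u‖ * ‖v‖)
    (hc_skew : ∀ w v : V, c w v v = 0)
    (hh_bdd : ∀ (w : V) (θ r : Z), |h w θ r| ≤ lam2 * ‖w‖ * ‖θ‖ * ‖r‖)
    (hh_skew : ∀ (w : V) (r : Z), h w r r = 0)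
    (hQ_bdd : ∀ (θ : Z) (v : V), |Q θ v| ≤ lamq * ‖θ‖ * ‖v‖)
    (hL_bdd : ∀ v : V, |L v| ≤ Lam * ‖v‖)
    (hPsi_bdd : ∀ r : Z, |Ψ r| ≤ lampsi * ‖r‖)
    {W : Type*} [NormedAddCommGroup W] [InnerProductSpace ℝ W] [CompleteSpace W]
    (B : W →ₗ[ℝ] V →ₗ[ℝ] ℝ) (betastar : ℝ) (hbetastar : 0 < betastar)
    (hinfsup : ∀ q : W, betastar * ‖q‖ ≤ ⨆ v : {v : V // v ≠ 0}, B q (v : V) / ‖(v : V)‖)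
    (hsig_pos : 0 < (lam2 * Lam / Cmin ^ 2 + lam2 * lamq * lampsi / Cmin ^ 2 + lam2 * lamq * lampsi / Cmin + lam2 * Lam / Cmin)) (hsig_lt : (lam2 * Lam / Cmin ^ 2 + lam2 * lamq * lampsi / Cmin ^ 2 + lam2 * lamq * lampsi / Cmin + lam2 * Lam / Cmin) < 1 / 3)
    (n : ℕ) (hn : 1 ≤ n)
    (u uN uPrev : V) (θ θN : Z) (ξ ξN : W)
    (hu : ∀ v : V, a u v + c u u v + B ξ v + Q θ v = L v)
    (huN : ∀ v : V, a uN v + c uPrev uN v + c uN uPrev v - c uPrev uPrev v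
      + B ξN v + Q θN v = L v)
    (hprevbdd : ‖uPrev‖ ≤ (4 / 3) * ((Lam + lamq * lampsi) / Cmin))
    (herrN : ‖u - uN‖ ≤ ((9 / 5) * (lam2 * Lam / Cmin ^ 2 + lam2 * lamq * lampsi / Cmin ^ 2 + lam2 * lamq * lampsi / Cmin + lam2 * Lam / Cmin)) ^ (2 ^ n - 1) * ((Lam + lamq * lampsi) / Cmin))
    (herrPrev : ‖u - uPrev‖ ≤ ((9 / 5) * (lam2 * Lam / Cmin ^ 2 + lam2 * lamq * lampsi / Cmin ^ 2 + lam2 * lamq * lampsi / Cmin + lam2 * Lam / Cmin)) ^ (2 ^ (n - 1) - 1) * ((Lam + lamq * lampsi) / Cmin))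
    (herrθ : ‖θ - θN‖ ≤ ((9 / 5) * (lam2 * Lam / Cmin ^ 2 + lam2 * lamq * lampsi / Cmin ^ 2 + lam2 * lamq * lampsi / Cmin + lam2 * Lam / Cmin)) ^ (2 ^ n - 1) * lampsi) :
    betastar * ‖ξ - ξN‖ ≤ (Cmax + (22 / 9) * Cmin) * ((9 / 5) * (lam2 * Lam / Cmin ^ 2 + lam2 * lamq * lampsi / Cmin ^ 2 + lam2 * lamq * lampsi / Cmin + lam2 * Lam / Cmin)) ^ (2 ^ n - 1) * ((Lam + lamq * lampsi) / Cmin) := by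
  set σ := lam2 * Lam / Cmin ^ 2 + lam2 * lamq * lampsi / Cmin ^ 2
    + lam2 * lamq * lampsi / Cmin + lam2 * Lam / Cmin with hσ
  set C₀ := (Lam + lamq * lampsi) / Cmin with hC₀
  have hC₀_nonneg : 0 ≤ C₀ := by positivity
  have hCmin_C₀ : Cmin * C₀ = Lam + lamq * lampsi := by rw [hC₀]; field_simp
  have hlam2_C₀ : lam2 * C₀ ≤ σ * Cmin := by
    have hσ_eq : σ * Cmin = lam2 * C₀ + lam2 * C₀ * Cmin := by
      rw [hσ, hC₀]; field_simp; ring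
    have : 0 ≤ lam2 * C₀ * Cmin := by positivity
    linarith
  set t := 9 / 5 * σ with ht
  have ht_nonneg : 0 ≤ t := by positivity
  obtain ⟨m, rfl⟩ : ∃ m, n = m + 1 := ⟨n - 1, by omega⟩
  simp only [Nat.add_sub_cancel] at herrPrev
  have hpow : t ^ (2 ^ (m + 1) - 1) = t * (t ^ (2 ^ m - 1)) ^ 2 := by
    rw [← pow_mul, ← pow_succ']
    congr 1
    have := Nat.one_le_two_pow (n := m)
    rw [pow_succ]
    omega
  set T := t ^ (2 ^ (m + 1) - 1)
  set S := t ^ (2 ^ m - 1)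
  have hT_nonneg : 0 ≤ T := by positivity
  have hquad : lam2 * ‖u - uPrev‖ * ‖u - uPrev‖ ≤ 5 / 9 * Cmin * (T * C₀) :=
    calc lam2 * ‖u - uPrev‖ * ‖u - uPrev‖ ≤ lam2 * (S * C₀) * (S * C₀) := by gcongr
      _ = (lam2 * C₀) * (S ^ 2 * C₀) := by ring
      _ ≤ (σ * Cmin) * (S ^ 2 * C₀) := by gcongr
      _ = 5 / 9 * Cmin * (T * C₀) := by rw [hpow, ht]; ring
  have hlin : lam2 * ‖uPrev‖ * ‖u - uN‖ ≤ 4 / 9 * Cmin * (T * C₀) :=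
    calc lam2 * ‖uPrev‖ * ‖u - uN‖ ≤ lam2 * (4 / 3 * C₀) * (T * C₀) := by gcongr
      _ = 4 / 3 * (lam2 * C₀) * (T * C₀) := by ring
      _ ≤ 4 / 3 * (1 / 3 * Cmin) * (T * C₀) := by
        have : lam2 * C₀ ≤ 1 / 3 * Cmin := hlam2_C₀.trans (by gcongr)
        exact mul_le_mul_of_nonneg_right (by linarith) (by positivity)
      _ = 4 / 9 * Cmin * (T * C₀) := by ring
  have htemp : lamq * ‖θ - θN‖ ≤ Cmin * (T * C₀) :=
    calc lamq * ‖θ - θN‖ ≤ lamq * (T * lampsi) := by gcongr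
      _ = T * (lamq * lampsi) := by ring
      _ ≤ T * (Cmin * C₀) := mul_le_mul_of_nonneg_left (by linarith) hT_nonneg
      _ = Cmin * (T * C₀) := by ring
  have hvisc : Cmax * ‖u - uN‖ ≤ Cmax * (T * C₀) := by gcongr
  have hbound : ∀ v : V, B (ξ - ξN) v ≤ (Cmax + 22 / 9 * Cmin) * T * C₀ * ‖v‖ := by
    intro v
    have herr : B (ξ - ξN) v = -(a (u - uN) v + c (u - uPrev) (u - uPrev) v
        + c uPrev (u - uN) v + c (u - uN) uPrev v + Q (θ - θN) v) := by
      simp only [map_sub, LinearMap.sub_apply]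
      linarith [hu v, huN v]
    have h₁ := neg_le_of_abs_le (ha_bdd (u - uN) v)
    have h₂ := neg_le_of_abs_le (hc_bdd (u - uPrev) (u - uPrev) v)
    have h₃ := neg_le_of_abs_le (hc_bdd uPrev (u - uN) v)
    have h₄ := neg_le_of_abs_le (hc_bdd (u - uN) uPrev v)
    have h₅ := neg_le_of_abs_le (hQ_bdd (θ - θN) v)
    calc B (ξ - ξN) v
        ≤ (Cmax * ‖u - uN‖ + lam2 * ‖u - uPrev‖ * ‖u - uPrev‖
          + 2 * (lam2 * ‖uPrev‖ * ‖u - uN‖) + lamq * ‖θ - θN‖) * ‖v‖ := by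
          rw [herr]; linarith
      _ ≤ (Cmax + 22 / 9 * Cmin) * T * C₀ * ‖v‖ := by gcongr; linarith
  refine (hinfsup (ξ - ξN)).trans (Real.iSup_le (fun v => ?_) (by positivity))
  rw [div_le_iff₀ (norm_pos_iff.mpr v.2)]
  exact hbound v
end

section
/- (Convergence of the Oseen iteration.) In the abstract framework, let (u, θ) ∈ V × Z solve the coupled problem, and let (uⁿ)ₙ≥₀ ⊆ V and (θⁿ)ₙ≥₀ ⊆ Z satisfy: e(θ⁰,r) = Ψ(r) for all r ∈ Z, a(u⁰,v) + Q(θ⁰,v) = L(v) for all v ∈ V, and for every n ≥ 1: a(uⁿ,v) + c(uⁿ⁻¹,uⁿ,v) + Q(θⁿ,v) = L(v) for all v ∈ V and e(θⁿ,r) + h(uⁿ⁻¹,θⁿ,r) = Ψ(r) for all r ∈ Z. If 0 < σ < 1, then for every n ≥ 0 one has ‖u − uⁿ‖ ≤ σⁿ⁺¹·C₀ and ‖θ − θⁿ‖ ≤ σⁿ⁺¹·λ_ψ. -/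
/-- Stability of a coercive problem with a skew transport term under a perturbation of the
transport field and of the right-hand side. -/
theorem coercive_transport_stability {V X : Type*} [NormedAddCommGroup V] [Module ℝ V]
    [NormedAddCommGroup X] [Module ℝ X] {C M K : ℝ} (hM : 0 ≤ M) (hK : 0 ≤ K)
    (a : X →ₗ[ℝ] X →ₗ[ℝ] ℝ) (c : V →ₗ[ℝ] X →ₗ[ℝ] X →ₗ[ℝ] ℝ)
    (ha : ∀ v, C * ‖v‖ ^ 2 ≤ a v v) (hc : ∀ w x v, |c w x v| ≤ M * ‖w‖ * ‖x‖ * ‖v‖)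
    (hskew : ∀ w v, c w v v = 0) {u w : V} {x y : X} {F G : X → ℝ}
    (hx : ∀ v, a x v + c u x v = F v) (hy : ∀ v, a y v + c w y v = G v)
    (hFG : ∀ v, |F v - G v| ≤ K * ‖v‖) :
    C * ‖x - y‖ ≤ M * ‖u - w‖ * ‖x‖ + K := by
  have herr : a (x - y) (x - y) = F (x - y) - G (x - y) - c (u - w) x (x - y) := by
    have hsk := hskew w (x - y)
    rw [← hx, ← hy]
    simp only [map_sub, LinearMap.sub_apply] at hsk ⊢
    linarith
  have hsq : C * ‖x - y‖ ^ 2 ≤ (M * ‖u - w‖ * ‖x‖ + K) * ‖x - y‖ := by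
    have hF := (abs_le.mp (hFG (x - y))).2
    have hcx := (abs_le.mp (hc (u - w) x (x - y))).1
    linarith [ha (x - y)]
  rcases (norm_nonneg (x - y)).eq_or_lt with h0 | hpos
  · rw [← h0, mul_zero]
    positivity
  · exact le_of_mul_le_mul_right (by linarith) hpos

/-- A priori bound for a coercive problem with a skew transport term. -/
theorem coercive_transport_bound {V X : Type*} [NormedAddCommGroup V] [Module ℝ V]
    [NormedAddCommGroup X] [Module ℝ X] {C M K : ℝ} (hM : 0 ≤ M) (hK : 0 ≤ K)
    (a : X →ₗ[ℝ] X →ₗ[ℝ] ℝ) (c : V →ₗ[ℝ] X →ₗ[ℝ] X →ₗ[ℝ] ℝ)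
    (ha : ∀ v, C * ‖v‖ ^ 2 ≤ a v v) (hc : ∀ w x v, |c w x v| ≤ M * ‖w‖ * ‖x‖ * ‖v‖)
    (hskew : ∀ w v, c w v v = 0) {u : V} {x : X} {F : X → ℝ}
    (hx : ∀ v, a x v + c u x v = F v) (hF : ∀ v, |F v| ≤ K * ‖v‖) :
    C * ‖x‖ ≤ K := by
  simpa using coercive_transport_stability (w := u) (y := 0) (G := 0) hM hK a c ha hc hskew hx
    (by simp) (by simpa using hF)


theorem stmt_16
    {V Z : Type*} [NormedAddCommGroup V] [InnerProductSpace ℝ V] [CompleteSpace V]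
    [NormedAddCommGroup Z] [InnerProductSpace ℝ Z] [CompleteSpace Z]
    (Cmin Cmax lam2 lamq Lam lampsi : ℝ)
    (hCmin : 0 < Cmin) (hCmax : 0 ≤ Cmax) (hlam2 : 0 ≤ lam2)
    (hlamq : 0 ≤ lamq) (hLam : 0 ≤ Lam) (hlampsi : 0 ≤ lampsi)
    (a : V →ₗ[ℝ] V →ₗ[ℝ] ℝ) (e : Z →ₗ[ℝ] Z →ₗ[ℝ] ℝ)
    (c : V →ₗ[ℝ] V →ₗ[ℝ] V →ₗ[ℝ] ℝ) (h : V →ₗ[ℝ] Z →ₗ[ℝ] Z →ₗ[ℝ] ℝ)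
    (Q : Z →ₗ[ℝ] V →ₗ[ℝ] ℝ) (L : V →ₗ[ℝ] ℝ) (Ψ : Z →ₗ[ℝ] ℝ)
    (ha_bdd : ∀ u v : V, |a u v| ≤ Cmax * ‖u‖ * ‖v‖)
    (ha_coer : ∀ v : V, Cmin * ‖v‖ ^ 2 ≤ a v v)
    (he_bdd : ∀ θ r : Z, |e θ r| ≤ ‖θ‖ * ‖r‖)
    (he_coer : ∀ r : Z, ‖r‖ ^ 2 ≤ e r r)
    (hc_bdd : ∀ w u v : V, |c w u v| ≤ lam2 * ‖w‖ * ‖u‖ * ‖v‖)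
    (hc_skew : ∀ w v : V, c w v v = 0)
    (hh_bdd : ∀ (w : V) (θ r : Z), |h w θ r| ≤ lam2 * ‖w‖ * ‖θ‖ * ‖r‖)
    (hh_skew : ∀ (w : V) (r : Z), h w r r = 0)
    (hQ_bdd : ∀ (θ : Z) (v : V), |Q θ v| ≤ lamq * ‖θ‖ * ‖v‖)
    (hL_bdd : ∀ v : V, |L v| ≤ Lam * ‖v‖)
    (hPsi_bdd : ∀ r : Z, |Ψ r| ≤ lampsi * ‖r‖)
    (u : V) (θ : Z)
    (hu : ∀ v : V, a u v + c u u v + Q θ v = L v)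
    (hθ : ∀ r : Z, e θ r + h u θ r = Ψ r)
    (un : ℕ → V) (θn : ℕ → Z)
    (h0e : ∀ r : Z, e (θn 0) r = Ψ r)
    (h0a : ∀ v : V, a (un 0) v + Q (θn 0) v = L v)
    (hstep_a : ∀ (n : ℕ) (v : V),
      a (un (n + 1)) v + c (un n) (un (n + 1)) v + Q (θn (n + 1)) v = L v)
    (hstep_e : ∀ (n : ℕ) (r : Z),
      e (θn (n + 1)) r + h (un n) (θn (n + 1)) r = Ψ r)
    (hsig_pos : 0 < (lam2 * Lam / Cmin ^ 2 + lam2 * lamq * lampsi / Cmin ^ 2 + lam2 * lamq * lampsi / Cmin + lam2 * Lam / Cmin)) (hsig_lt : (lam2 * Lam / Cmin ^ 2 + lam2 * lamq * lampsi / Cmin ^ 2 + lam2 * lamq * lampsi / Cmin + lam2 * Lam / Cmin) < 1) :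
    ∀ n : ℕ, ‖u - un n‖ ≤ (lam2 * Lam / Cmin ^ 2 + lam2 * lamq * lampsi / Cmin ^ 2 + lam2 * lamq * lampsi / Cmin + lam2 * Lam / Cmin) ^ (n + 1) * ((Lam + lamq * lampsi) / Cmin) ∧
      ‖θ - θn n‖ ≤ (lam2 * Lam / Cmin ^ 2 + lam2 * lamq * lampsi / Cmin ^ 2 + lam2 * lamq * lampsi / Cmin + lam2 * Lam / Cmin) ^ (n + 1) * lampsi := by
  have he_coer' : ∀ r : Z, 1 * ‖r‖ ^ 2 ≤ e r r := by simpa using he_coer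
  have hθ_le : ‖θ‖ ≤ lampsi := by
    simpa using coercive_transport_bound hlam2 hlampsi e h he_coer' hh_bdd hh_skew hθ hPsi_bdd
  set C₀ := (Lam + lamq * lampsi) / Cmin with hC₀
  have hC₀_nonneg : 0 ≤ C₀ := by positivity
  have hu_le : ‖u‖ ≤ C₀ := by
    rw [hC₀, le_div_iff₀' hCmin]
    refine coercive_transport_bound hlam2 (by positivity) a c ha_coer hc_bdd hc_skew
      (F := fun v ↦ L v - Q θ v) (fun v ↦ by linarith [hu v]) fun v ↦ ?_
    calc |L v - Q θ v| ≤ |L v| + |Q θ v| := abs_sub _ _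
      _ ≤ Lam * ‖v‖ + lamq * ‖θ‖ * ‖v‖ := add_le_add (hL_bdd v) (hQ_bdd θ v)
      _ ≤ Lam * ‖v‖ + lamq * lampsi * ‖v‖ := by gcongr
      _ = (Lam + lamq * lampsi) * ‖v‖ := by ring
  have hσ_eq : lam2 * Lam / Cmin ^ 2 + lam2 * lamq * lampsi / Cmin ^ 2
      + lam2 * lamq * lampsi / Cmin + lam2 * Lam / Cmin = lam2 * C₀ / Cmin + lam2 * C₀ := by
    rw [hC₀]
    field_simp
    ring
  rw [hσ_eq] at hsig_pos ⊢
  set σ := lam2 * C₀ / Cmin + lam2 * C₀ with hσ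
  have hθ_rate : lam2 * C₀ ≤ σ := le_add_of_nonneg_left (by positivity)
  have hu_rate : lam2 * C₀ + lamq * (lam2 * lampsi) ≤ Cmin * σ := by
    have hCC₀ : Cmin * C₀ = Lam + lamq * lampsi := mul_div_cancel₀ _ hCmin.ne'
    have hCσ : Cmin * σ = lam2 * C₀ + lam2 * (Cmin * C₀) := by
      rw [hσ]
      field_simp
    rw [hCσ, hCC₀]
    linarith [mul_nonneg hlam2 hLam]
  have contraction : ∀ (n : ℕ) (w u' : V) (θ' : Z),
      (∀ v, a u' v + c w u' v + Q θ' v = L v) → (∀ r, e θ' r + h w θ' r = Ψ r) →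
      ‖u - w‖ ≤ σ ^ n * C₀ → ‖u - u'‖ ≤ σ ^ (n + 1) * C₀ ∧ ‖θ - θ'‖ ≤ σ ^ (n + 1) * lampsi := by
    intro n w u' θ' hu' hθ' hw
    have hθ_err : ‖θ - θ'‖ ≤ lam2 * ‖u - w‖ * ‖θ‖ := by
      simpa using coercive_transport_stability hlam2 le_rfl e h he_coer' hh_bdd hh_skew hθ hθ'
        (by simp)
    have hu_err : Cmin * ‖u - u'‖ ≤ lam2 * ‖u - w‖ * ‖u‖ + lamq * ‖θ - θ'‖ := by
      refine coercive_transport_stability hlam2 (by positivity) a c ha_coer hc_bdd hc_skew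
        (F := fun v ↦ L v - Q θ v) (G := fun v ↦ L v - Q θ' v)
        (fun v ↦ by linarith [hu v]) (fun v ↦ by linarith [hu' v]) fun v ↦ ?_
      rw [sub_sub_sub_cancel_left, abs_sub_comm]
      simpa using hQ_bdd (θ - θ') v
    constructor
    · refine le_of_mul_le_mul_left ?_ hCmin
      calc Cmin * ‖u - u'‖ ≤ lam2 * ‖u - w‖ * C₀ + lamq * (lam2 * ‖u - w‖ * lampsi) := by
            refine hu_err.trans ?_
            gcongr
            exact hθ_err.trans (by gcongr)
        _ = (lam2 * C₀ + lamq * (lam2 * lampsi)) * ‖u - w‖ := by ring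
        _ ≤ Cmin * σ * (σ ^ n * C₀) := by gcongr
        _ = Cmin * (σ ^ (n + 1) * C₀) := by ring
    · calc ‖θ - θ'‖ ≤ lam2 * (σ ^ n * C₀) * lampsi := hθ_err.trans (by gcongr)
        _ = lam2 * C₀ * (σ ^ n * lampsi) := by ring
        _ ≤ σ * (σ ^ n * lampsi) := by gcongr
        _ = σ ^ (n + 1) * lampsi := by ring
  intro n
  induction n with
  | zero =>
    exact contraction 0 0 _ _ (by simpa using h0a) (by simpa using h0e) (by simpa using hu_le)
  | succ n ih => exact contraction (n + 1) _ _ _ (hstep_a n) (hstep_e n) ih.1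
end

section
/- (Pressure convergence of the Oseen iteration.) In the abstract framework with the inf-sup form B, assume 0 < σ < 1, fix n ≥ 1 and suppose: (u, θ, ξ) ∈ V × Z × W satisfies a(u,v) + c(u,u,v) + B(ξ,v) + Q(θ,v) = L(v) for all v ∈ V; (uⁿ, θⁿ, ξⁿ) satisfies a(uⁿ,v) + c(uⁿ⁻¹,uⁿ,v) + B(ξⁿ,v) + Q(θⁿ,v) = L(v) for all v ∈ V, where uⁿ⁻¹ ∈ V is the previous iterate; and the bounds ‖u‖ ≤ C₀, ‖uⁿ⁻¹‖ ≤ C₀, ‖u − uⁿ‖ ≤ σⁿ⁺¹C₀, ‖u − uⁿ⁻¹‖ ≤ σⁿC₀ and ‖θ − θⁿ‖ ≤ σⁿ⁺¹λ_ψ hold. Then β*·‖ξ − ξⁿ‖ ≤ (C_max + 3·C_min)·σⁿ⁺¹·C₀. -/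
theorem stmt_17
    {V Z : Type*} [NormedAddCommGroup V] [InnerProductSpace ℝ V] [CompleteSpace V]
    [NormedAddCommGroup Z] [InnerProductSpace ℝ Z] [CompleteSpace Z]
    (Cmin Cmax lam2 lamq Lam lampsi : ℝ)
    (hCmin : 0 < Cmin) (hCmax : 0 ≤ Cmax) (hlam2 : 0 ≤ lam2)
    (hlamq : 0 ≤ lamq) (hLam : 0 ≤ Lam) (hlampsi : 0 ≤ lampsi)
    (a : V →ₗ[ℝ] V →ₗ[ℝ] ℝ) (e : Z →ₗ[ℝ] Z →ₗ[ℝ] ℝ)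
    (c : V →ₗ[ℝ] V →ₗ[ℝ] V →ₗ[ℝ] ℝ) (h : V →ₗ[ℝ] Z →ₗ[ℝ] Z →ₗ[ℝ] ℝ)
    (Q : Z →ₗ[ℝ] V →ₗ[ℝ] ℝ) (L : V →ₗ[ℝ] ℝ) (Ψ : Z →ₗ[ℝ] ℝ)
    (ha_bdd : ∀ u v : V, |a u v| ≤ Cmax * ‖u‖ * ‖v‖)
    (ha_coer : ∀ v : V, Cmin * ‖v‖ ^ 2 ≤ a v v)
    (he_bdd : ∀ θ r : Z, |e θ r| ≤ ‖θ‖ * ‖r‖)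
    (he_coer : ∀ r : Z, ‖r‖ ^ 2 ≤ e r r)
    (hc_bdd : ∀ w u v : V, |c w u v| ≤ lam2 * ‖w‖ * ‖u‖ * ‖v‖)
    (hc_skew : ∀ w v : V, c w v v = 0)
    (hh_bdd : ∀ (w : V) (θ r : Z), |h w θ r| ≤ lam2 * ‖w‖ * ‖θ‖ * ‖r‖)
    (hh_skew : ∀ (w : V) (r : Z), h w r r = 0)
    (hQ_bdd : ∀ (θ : Z) (v : V), |Q θ v| ≤ lamq * ‖θ‖ * ‖v‖)
    (hL_bdd : ∀ v : V, |L v| ≤ Lam * ‖v‖)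
    (hPsi_bdd : ∀ r : Z, |Ψ r| ≤ lampsi * ‖r‖)
    {W : Type*} [NormedAddCommGroup W] [InnerProductSpace ℝ W] [CompleteSpace W]
    (B : W →ₗ[ℝ] V →ₗ[ℝ] ℝ) (betastar : ℝ) (hbetastar : 0 < betastar)
    (hinfsup : ∀ q : W, betastar * ‖q‖ ≤ ⨆ v : {v : V // v ≠ 0}, B q (v : V) / ‖(v : V)‖)
    (hsig_pos : 0 < (lam2 * Lam / Cmin ^ 2 + lam2 * lamq * lampsi / Cmin ^ 2 + lam2 * lamq * lampsi / Cmin + lam2 * Lam / Cmin)) (hsig_lt : (lam2 * Lam / Cmin ^ 2 + lam2 * lamq * lampsi / Cmin ^ 2 + lam2 * lamq * lampsi / Cmin + lam2 * Lam / Cmin) < 1)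
    (n : ℕ) (hn : 1 ≤ n)
    (u uN uPrev : V) (θ θN : Z) (ξ ξN : W)
    (hu : ∀ v : V, a u v + c u u v + B ξ v + Q θ v = L v)
    (huN : ∀ v : V, a uN v + c uPrev uN v + B ξN v + Q θN v = L v)
    (hubdd : ‖u‖ ≤ ((Lam + lamq * lampsi) / Cmin))
    (hprevbdd : ‖uPrev‖ ≤ ((Lam + lamq * lampsi) / Cmin))
    (herrN : ‖u - uN‖ ≤ (lam2 * Lam / Cmin ^ 2 + lam2 * lamq * lampsi / Cmin ^ 2 + lam2 * lamq * lampsi / Cmin + lam2 * Lam / Cmin) ^ (n + 1) * ((Lam + lamq * lampsi) / Cmin))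
    (herrPrev : ‖u - uPrev‖ ≤ (lam2 * Lam / Cmin ^ 2 + lam2 * lamq * lampsi / Cmin ^ 2 + lam2 * lamq * lampsi / Cmin + lam2 * Lam / Cmin) ^ n * ((Lam + lamq * lampsi) / Cmin))
    (herrθ : ‖θ - θN‖ ≤ (lam2 * Lam / Cmin ^ 2 + lam2 * lamq * lampsi / Cmin ^ 2 + lam2 * lamq * lampsi / Cmin + lam2 * Lam / Cmin) ^ (n + 1) * lampsi) :
    betastar * ‖ξ - ξN‖ ≤ (Cmax + 3 * Cmin) * (lam2 * Lam / Cmin ^ 2 + lam2 * lamq * lampsi / Cmin ^ 2 + lam2 * lamq * lampsi / Cmin + lam2 * Lam / Cmin) ^ (n + 1) * ((Lam + lamq * lampsi) / Cmin) := by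
  set σ := lam2 * Lam / Cmin ^ 2 + lam2 * lamq * lampsi / Cmin ^ 2 +
    lam2 * lamq * lampsi / Cmin + lam2 * Lam / Cmin with hσ
  set C₀ := (Lam + lamq * lampsi) / Cmin with hC₀
  have hC₀_nonneg : 0 ≤ C₀ := by positivity
  have hpow : 0 ≤ σ ^ n := by positivity
  have hpow' : 0 ≤ σ ^ (n + 1) := by positivity
  have hσ_eq : σ * Cmin = lam2 * C₀ + lam2 * C₀ * Cmin := by
    rw [hσ, hC₀]
    field_simp
    ring
  have hlamC₀ : lam2 * C₀ ≤ σ * Cmin := by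
    have : 0 ≤ lam2 * C₀ * Cmin := by positivity
    linarith
  have hlamC₀' : lam2 * C₀ ≤ Cmin := by nlinarith
  have hlamq_psi : lamq * lampsi ≤ Cmin * C₀ := by
    rw [hC₀, mul_div_cancel₀ _ hCmin.ne']
    linarith
  refine (hinfsup (ξ - ξN)).trans (Real.iSup_le ?_ (by positivity))
  rintro ⟨v, hv⟩
  rw [div_le_iff₀ (norm_pos_iff.mpr hv)]
  have hB : B (ξ - ξN) v =
      -a (u - uN) v - c (u - uPrev) u v - c uPrev (u - uN) v - Q (θ - θN) v := by
    simp only [map_sub, LinearMap.sub_apply]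
    linarith [hu v, huN v]
  have ha : |a (u - uN) v| ≤ Cmax * σ ^ (n + 1) * C₀ * ‖v‖ := by
    calc |a (u - uN) v| ≤ Cmax * ‖u - uN‖ * ‖v‖ := ha_bdd _ _
      _ ≤ Cmax * (σ ^ (n + 1) * C₀) * ‖v‖ := by gcongr
      _ = _ := by ring
  have hc₁ : |c (u - uPrev) u v| ≤ Cmin * σ ^ (n + 1) * C₀ * ‖v‖ := by
    calc |c (u - uPrev) u v| ≤ lam2 * ‖u - uPrev‖ * ‖u‖ * ‖v‖ := hc_bdd _ _ _
      _ ≤ lam2 * (σ ^ n * C₀) * C₀ * ‖v‖ := by gcongr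
      _ = (lam2 * C₀) * (σ ^ n * C₀ * ‖v‖) := by ring
      _ ≤ (σ * Cmin) * (σ ^ n * C₀ * ‖v‖) := by gcongr
      _ = _ := by ring
  have hc₂ : |c uPrev (u - uN) v| ≤ Cmin * σ ^ (n + 1) * C₀ * ‖v‖ := by
    calc |c uPrev (u - uN) v| ≤ lam2 * ‖uPrev‖ * ‖u - uN‖ * ‖v‖ := hc_bdd _ _ _
      _ ≤ lam2 * C₀ * (σ ^ (n + 1) * C₀) * ‖v‖ := by gcongr
      _ ≤ Cmin * (σ ^ (n + 1) * C₀) * ‖v‖ := by gcongr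
      _ = _ := by ring
  have hQ : |Q (θ - θN) v| ≤ Cmin * σ ^ (n + 1) * C₀ * ‖v‖ := by
    calc |Q (θ - θN) v| ≤ lamq * ‖θ - θN‖ * ‖v‖ := hQ_bdd _ _
      _ ≤ lamq * (σ ^ (n + 1) * lampsi) * ‖v‖ := by gcongr
      _ = (lamq * lampsi) * (σ ^ (n + 1) * ‖v‖) := by ring
      _ ≤ (Cmin * C₀) * (σ ^ (n + 1) * ‖v‖) := by gcongr
      _ = _ := by ring
  linarith [neg_le_of_abs_le ha, neg_le_of_abs_le hc₁, neg_le_of_abs_le hc₂, neg_le_of_abs_le hQ]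
end

section
/- (Céa-type quasi-optimal error estimate, core of Theorem 3.4.) In the abstract framework, let V_h ⊆ V and Z_h ⊆ Z be closed subspaces, assume σ < 1, let (u, θ) ∈ V × Z solve the coupled problem, and let (u_h, θ_h) ∈ V_h × Z_h satisfy a(u_h,v_h) + c(u_h,u_h,v_h) + Q(θ_h,v_h) = L(v_h) for all v_h ∈ V_h and e(θ_h,r_h) + h(u_h,θ_h,r_h) = Ψ(r_h) for all r_h ∈ Z_h. Then there exists a constant C ≥ 0, depending only on C_min, C_max, λ₂, λ_q, λ_ψ, Λ and σ, such that ‖u − u_h‖ + ‖θ − θ_h‖ ≤ C·( inf over v_h ∈ V_h of ‖u − v_h‖ + inf over s_h ∈ Z_h of ‖θ − s_h‖ ). -/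
/-- Cancel one factor `x` in an energy inequality. -/
theorem mul_le_of_mul_sq_le_s18 {k M x : ℝ} (hM : 0 ≤ M) (hx : 0 ≤ x)
    (h : k * x ^ 2 ≤ M * x) : k * x ≤ M := by
  rcases hx.eq_or_lt with rfl | hx
  · simpa using hM
  · refine le_of_mul_le_mul_right ?_ hx
    linarith [h, sq x, mul_assoc k x x]

section Estimates

variable {V Z : Type*} [NormedAddCommGroup V] [InnerProductSpace ℝ V]
  [NormedAddCommGroup Z] [InnerProductSpace ℝ Z]

/-- A priori bound for the temperature. -/
theorem norm_temperature_le {lampsi : ℝ} (hlampsi : 0 ≤ lampsi)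
    {e : Z →ₗ[ℝ] Z →ₗ[ℝ] ℝ} {h : V →ₗ[ℝ] Z →ₗ[ℝ] Z →ₗ[ℝ] ℝ} {Ψ : Z →ₗ[ℝ] ℝ}
    (he : ∀ r, ‖r‖ ^ 2 ≤ e r r) (hh : ∀ w r, h w r r = 0) (hΨ : ∀ r, |Ψ r| ≤ lampsi * ‖r‖)
    {u : V} {θ : Z} (hθ : e θ θ + h u θ θ = Ψ θ) : ‖θ‖ ≤ lampsi := by
  have key := mul_le_of_mul_sq_le_s18 (k := 1) hlampsi (norm_nonneg θ)
    (by linarith [he θ, hh u θ, le_abs_self (Ψ θ), hΨ θ])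
  linarith

/-- A priori bound for the velocity. -/
theorem norm_velocity_le {Cmin lamq Lam lampsi : ℝ} (hCmin : 0 < Cmin) (hlamq : 0 ≤ lamq)
    (hLam : 0 ≤ Lam) (hlampsi : 0 ≤ lampsi)
    {a : V →ₗ[ℝ] V →ₗ[ℝ] ℝ} {c : V →ₗ[ℝ] V →ₗ[ℝ] V →ₗ[ℝ] ℝ} {Q : Z →ₗ[ℝ] V →ₗ[ℝ] ℝ}
    {L : V →ₗ[ℝ] ℝ} (ha : ∀ v, Cmin * ‖v‖ ^ 2 ≤ a v v) (hc : ∀ w v, c w v v = 0)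
    (hQ : ∀ θ v, |Q θ v| ≤ lamq * ‖θ‖ * ‖v‖) (hL : ∀ v, |L v| ≤ Lam * ‖v‖)
    {u : V} {θ : Z} (hθ : ‖θ‖ ≤ lampsi) (hu : a u u + c u u u + Q θ u = L u) :
    ‖u‖ ≤ (Lam + lamq * lampsi) / Cmin := by
  have hQu : |Q θ u| ≤ lamq * lampsi * ‖u‖ := (hQ θ u).trans (by gcongr)
  rw [le_div_iff₀' hCmin]
  refine mul_le_of_mul_sq_le_s18 (by positivity) (norm_nonneg u) ?_
  linarith [ha u, hc u u, le_abs_self (L u), hL u, neg_abs_le (Q θ u)]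

/-- Temperature error in terms of its approximation error and the velocity error. -/
theorem norm_temperature_sub_le {lam2 lampsi M : ℝ} (hlam2 : 0 ≤ lam2) (hlampsi : 0 ≤ lampsi)
    (hM : 0 ≤ M) {e : Z →ₗ[ℝ] Z →ₗ[ℝ] ℝ} {h : V →ₗ[ℝ] Z →ₗ[ℝ] Z →ₗ[ℝ] ℝ}
    (heb : ∀ θ r, |e θ r| ≤ ‖θ‖ * ‖r‖) (he : ∀ r, ‖r‖ ^ 2 ≤ e r r)
    (hhb : ∀ w θ r, |h w θ r| ≤ lam2 * ‖w‖ * ‖θ‖ * ‖r‖) (hh : ∀ w r, h w r r = 0)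
    {u uh : V} {θ θh s : Z} (hθ : ‖θ‖ ≤ lampsi) (huh : ‖uh‖ ≤ M)
    (horth : e θ (s - θh) + h u θ (s - θh) = e θh (s - θh) + h uh θh (s - θh)) :
    ‖θ - θh‖ ≤ (2 + lam2 * M) * ‖θ - s‖ + lam2 * lampsi * ‖u - uh‖ := by
  have h₁ := heb (θ - s) (s - θh)
  have h₂ : |h (u - uh) θ (s - θh)| ≤ lam2 * ‖u - uh‖ * lampsi * ‖s - θh‖ :=
    (hhb _ _ _).trans (by gcongr)
  have h₃ : |h uh (θ - s) (s - θh)| ≤ lam2 * M * ‖θ - s‖ * ‖s - θh‖ :=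
    (hhb _ _ _).trans (by gcongr)
  have expand : e (s - θh) (s - θh) = -e (θ - s) (s - θh) - h (u - uh) θ (s - θh)
      - h uh (θ - s) (s - θh) - h uh (s - θh) (s - θh) := by
    have hsub : ∀ r, e (s - θh) r + e (θ - s) r + h (u - uh) θ r + h uh (θ - s) r
        + h uh (s - θh) r = (e θ r + h u θ r) - (e θh r + h uh θh r) := fun r => by
      simp only [map_sub, LinearMap.sub_apply]
      ring
    linarith [hsub (s - θh)]
  have key := mul_le_of_mul_sq_le_s18 (k := 1)
    (M := ‖θ - s‖ + lam2 * ‖u - uh‖ * lampsi + lam2 * M * ‖θ - s‖) (by positivity)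
    (norm_nonneg (s - θh))
    (by linarith [he (s - θh), hh uh (s - θh), neg_le_of_abs_le h₁, neg_le_of_abs_le h₂,
      neg_le_of_abs_le h₃])
  linarith [norm_sub_le_norm_sub_add_norm_sub θ s θh]

/-- Velocity error in terms of its approximation error and the temperature error. -/
theorem mul_norm_velocity_sub_le {Cmin Cmax lam2 lamq M : ℝ} (hCmin : 0 < Cmin)
    (hCmax : 0 ≤ Cmax) (hlam2 : 0 ≤ lam2) (hlamq : 0 ≤ lamq) (hM : 0 ≤ M)
    {a : V →ₗ[ℝ] V →ₗ[ℝ] ℝ} {c : V →ₗ[ℝ] V →ₗ[ℝ] V →ₗ[ℝ] ℝ} {Q : Z →ₗ[ℝ] V →ₗ[ℝ] ℝ}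
    (hab : ∀ u v, |a u v| ≤ Cmax * ‖u‖ * ‖v‖) (ha : ∀ v, Cmin * ‖v‖ ^ 2 ≤ a v v)
    (hcb : ∀ w u v, |c w u v| ≤ lam2 * ‖w‖ * ‖u‖ * ‖v‖) (hc : ∀ w v, c w v v = 0)
    (hQ : ∀ θ v, |Q θ v| ≤ lamq * ‖θ‖ * ‖v‖)
    {u uh w : V} {θ θh : Z} (hu : ‖u‖ ≤ M) (huh : ‖uh‖ ≤ M)
    (horth : a u (w - uh) + c u u (w - uh) + Q θ (w - uh)
      = a uh (w - uh) + c uh uh (w - uh) + Q θh (w - uh)) :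
    Cmin * ‖u - uh‖ ≤ (Cmin + Cmax + lam2 * M) * ‖u - w‖ + lam2 * M * ‖u - uh‖
      + lamq * ‖θ - θh‖ := by
  have h₁ := hab (u - w) (w - uh)
  have h₂ : |c (u - uh) u (w - uh)| ≤ lam2 * ‖u - uh‖ * M * ‖w - uh‖ :=
    (hcb _ _ _).trans (by gcongr)
  have h₃ : |c uh (u - w) (w - uh)| ≤ lam2 * M * ‖u - w‖ * ‖w - uh‖ :=
    (hcb _ _ _).trans (by gcongr)
  have h₄ := hQ (θ - θh) (w - uh)
  have expand : a (w - uh) (w - uh) = -a (u - w) (w - uh) - c (u - uh) u (w - uh)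
      - c uh (u - w) (w - uh) - c uh (w - uh) (w - uh) - Q (θ - θh) (w - uh) := by
    have hsub : ∀ v, a (w - uh) v + a (u - w) v + c (u - uh) u v + c uh (u - w) v
        + c uh (w - uh) v + Q (θ - θh) v
        = (a u v + c u u v + Q θ v) - (a uh v + c uh uh v + Q θh v) := fun v => by
      simp only [map_sub, LinearMap.sub_apply]
      ring
    linarith [hsub (w - uh)]
  have key := mul_le_of_mul_sq_le_s18 (k := Cmin)
    (M := Cmax * ‖u - w‖ + lam2 * ‖u - uh‖ * M + lam2 * M * ‖u - w‖ + lamq * ‖θ - θh‖)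
    (by positivity) (norm_nonneg (w - uh))
    (by linarith [ha (w - uh), hc uh (w - uh), neg_le_of_abs_le h₁, neg_le_of_abs_le h₂,
      neg_le_of_abs_le h₃, neg_le_of_abs_le h₄])
  linarith [mul_le_mul_of_nonneg_left (norm_sub_le_norm_sub_add_norm_sub u w uh) hCmin.le]

end Estimates


theorem stmt_18
    (Cmin Cmax lam2 lamq Lam lampsi : ℝ)
    (hCmin : 0 < Cmin) (hCmax : 0 ≤ Cmax) (hlam2 : 0 ≤ lam2)
    (hlamq : 0 ≤ lamq) (hLam : 0 ≤ Lam) (hlampsi : 0 ≤ lampsi)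
    (hsigma : (lam2 * Lam / Cmin ^ 2 + lam2 * lamq * lampsi / Cmin ^ 2 + lam2 * lamq * lampsi / Cmin + lam2 * Lam / Cmin) < 1) :
    ∃ C : ℝ, 0 ≤ C ∧
      ∀ (V Z : Type) [NormedAddCommGroup V] [InnerProductSpace ℝ V] [CompleteSpace V]
        [NormedAddCommGroup Z] [InnerProductSpace ℝ Z] [CompleteSpace Z]
        (a : V →ₗ[ℝ] V →ₗ[ℝ] ℝ) (e : Z →ₗ[ℝ] Z →ₗ[ℝ] ℝ)
        (c : V →ₗ[ℝ] V →ₗ[ℝ] V →ₗ[ℝ] ℝ) (h : V →ₗ[ℝ] Z →ₗ[ℝ] Z →ₗ[ℝ] ℝ)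
        (Q : Z →ₗ[ℝ] V →ₗ[ℝ] ℝ) (L : V →ₗ[ℝ] ℝ) (Ψ : Z →ₗ[ℝ] ℝ),
        (∀ u v : V, |a u v| ≤ Cmax * ‖u‖ * ‖v‖) →
        (∀ v : V, Cmin * ‖v‖ ^ 2 ≤ a v v) →
        (∀ θ r : Z, |e θ r| ≤ ‖θ‖ * ‖r‖) →
        (∀ r : Z, ‖r‖ ^ 2 ≤ e r r) →
        (∀ w u v : V, |c w u v| ≤ lam2 * ‖w‖ * ‖u‖ * ‖v‖) →
        (∀ w v : V, c w v v = 0) →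
        (∀ (w : V) (θ r : Z), |h w θ r| ≤ lam2 * ‖w‖ * ‖θ‖ * ‖r‖) →
        (∀ (w : V) (r : Z), h w r r = 0) →
        (∀ (θ : Z) (v : V), |Q θ v| ≤ lamq * ‖θ‖ * ‖v‖) →
        (∀ v : V, |L v| ≤ Lam * ‖v‖) →
        (∀ r : Z, |Ψ r| ≤ lampsi * ‖r‖) →
        ∀ (Vh : Submodule ℝ V) (Zh : Submodule ℝ Z),
          IsClosed (Vh : Set V) → IsClosed (Zh : Set Z) →
          ∀ (u : V) (θ : Z) (uh : V) (θh : Z),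
            (∀ v : V, a u v + c u u v + Q θ v = L v) →
            (∀ r : Z, e θ r + h u θ r = Ψ r) →
            uh ∈ Vh → θh ∈ Zh →
            (∀ vh ∈ Vh, a uh vh + c uh uh vh + Q θh vh = L vh) →
            (∀ rh ∈ Zh, e θh rh + h uh θh rh = Ψ rh) →
            ‖u - uh‖ + ‖θ - θh‖ ≤
              C * ((⨅ vh : Vh, ‖u - (vh : V)‖) + ⨅ sh : Zh, ‖θ - (sh : Z)‖) := by
  set M := (Lam + lamq * lampsi) / Cmin with hMdef
  have hM : 0 ≤ M := by positivity
  set κ := Cmin - lam2 * M - lamq * (lam2 * lampsi) with hκdef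
  have hκ : 0 < κ := by
    have hκσ : κ / Cmin = 1 - (lam2 * Lam / Cmin ^ 2 + lam2 * lamq * lampsi / Cmin ^ 2
        + lam2 * lamq * lampsi / Cmin) := by
      rw [hκdef, hMdef]
      field_simp
      ring
    have hnonneg : 0 ≤ lam2 * Lam / Cmin := by positivity
    exact (div_pos_iff_of_pos_right hCmin).1 (by linarith)
  set A := Cmin + Cmax + lam2 * M with hA
  set D := 2 + lam2 * M with hD
  have hApos : 0 < A := by positivity
  have hDpos : 0 < D := by positivity
  set C := (1 + lam2 * lampsi) * ((A + lamq * D) / κ) + D with hC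
  have hCpos : 0 < C := by positivity
  refine ⟨C, hCpos.le, ?_⟩
  intro V Z _ _ _ _ _ _ a e c h Q L Ψ hab ha heb he hcb hc hhb hh hQ hL hΨ Vh Zh _ _ u θ uh θh
    hu hθ huhmem hθhmem huh hθh
  have hθn := norm_temperature_le hlampsi he hh hΨ (hθ θ)
  have hθhn := norm_temperature_le hlampsi he hh hΨ (hθh θh hθhmem)
  have hun := norm_velocity_le hCmin hlamq hLam hlampsi ha hc hQ hL hθn (hu u)
  have huhn := norm_velocity_le hCmin hlamq hLam hlampsi ha hc hQ hL hθhn (huh uh huhmem)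
  rw [← div_le_iff₀' hCpos]
  refine le_ciInf_add_ciInf fun w s => ?_
  rw [div_le_iff₀' hCpos]
  have hT := norm_temperature_sub_le hlam2 hlampsi hM heb he hhb hh (s := (s : Z)) hθn huhn
    ((hθ _).trans (hθh _ (Zh.sub_mem s.2 hθhmem)).symm)
  have hU := mul_norm_velocity_sub_le hCmin hCmax hlam2 hlamq hM hab ha hcb hc hQ (w := (w : V))
    hun huhn ((hu _).trans (huh _ (Vh.sub_mem w.2 huhmem)).symm)
  rw [← hA] at hU
  rw [← hD] at hT
  have hX := norm_nonneg (u - (w : V))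
  have hY := norm_nonneg (θ - (s : Z))
  generalize ‖u - (w : V)‖ = X at *
  generalize ‖θ - (s : Z)‖ = Y at *
  have hE : ‖u - uh‖ ≤ (A + lamq * D) / κ * (X + Y) := by
    rw [div_mul_eq_mul_div, le_div_iff₀' hκ]
    have hQT := mul_le_mul_of_nonneg_left hT hlamq
    have h₁ : 0 ≤ A * Y := by positivity
    have h₂ : 0 ≤ lamq * D * X := by positivity
    rw [hκdef]
    linarith
  calc ‖u - uh‖ + ‖θ - θh‖
      ≤ (1 + lam2 * lampsi) * ‖u - uh‖ + D * Y := by linarith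
    _ ≤ (1 + lam2 * lampsi) * ((A + lamq * D) / κ * (X + Y)) + D * (X + Y) := by
        gcongr
        linarith
    _ = C * (X + Y) := by
        rw [hC]
        ring
end
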